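/- arXiv:2202.07124 — 2 statements merged into one kernel-verified Lean document; each statement's English description precedes it below -/
import Mathlib

section
/- Let (X,ρ,μ) be a quasi-metric measure space in which μ is Borel regular and Q-doubling for some Q ∈ (0,∞), and let Ω ⊂ X be a μ-measurable locally uniformly perfect set. Suppose there exist s ∈ (0,∞), p ∈ (Q/s,∞), q ∈ (0,∞] with s ⪯_q ind(Ω,ρ), and a constant C_H > 0 such that for every ρ-ball B₀ = B_ρ(x₀,R₀) with x₀ ∈ Ω and R₀ ∈ (0,1], every u ∈ Ṁ^s_{p,q}(Ω,ρ,μ) has a representative (modulo μ-null sets), again denoted u, satisfying |u(x)−u(y)| ≤ C_H ρ(x,y)^{s−Q/p} R₀^{Q/p} μ(B₀)^{−1/p} ‖u‖_{Ṁ^s_{p,q}(Ω,ρ,μ)} for all x,y ∈ B₀∩Ω. Then Ω satisfies the measure density condition. -/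
open MeasureTheory ENNReal Set

noncomputable section

namespace HajlaszPaper

variable {X : Type*}

/-- The `ρ`-ball centered at `x` with radius `r`. -/
def qball (ρ : X → X → ℝ) (x : X) (r : ℝ) : Set X := {y | ρ x y < r}

/-- `ρ` is a quasi-metric on `X`. -/
def IsQuasiDist (ρ : X → X → ℝ) : Prop :=
  (∀ x y, 0 ≤ ρ x y) ∧ (∀ x y, ρ x y = 0 ↔ x = y) ∧
    (∃ C₀ : ℝ, 1 ≤ C₀ ∧ ∀ x y, ρ y x ≤ C₀ * ρ x y) ∧
    (∃ C₁ : ℝ, 1 ≤ C₁ ∧ ∀ x y z, ρ x y ≤ C₁ * max (ρ x z) (ρ z y))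

/-- The least admissible quasi-triangle constant `C_ρ`. -/
def Crho (ρ : X → X → ℝ) : ℝ :=
  sInf {C : ℝ | 1 ≤ C ∧ ∀ x y z : X, ρ x y ≤ C * max (ρ x z) (ρ z y)}

/-- The least admissible quasi-symmetry constant `C̃_ρ`. -/
def CrhoTilde (ρ : X → X → ℝ) : ℝ :=
  sInf {C : ℝ | 1 ≤ C ∧ ∀ x y : X, ρ y x ≤ C * ρ x y}

/-- Two quasi-metrics are (bi-Lipschitz, i.e. pointwise) equivalent. -/
def EquivQM (ρ ϱ : X → X → ℝ) : Prop :=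
  ∃ c : ℝ, 1 ≤ c ∧ ∀ x y, c⁻¹ * ϱ x y ≤ ρ x y ∧ ρ x y ≤ c * ϱ x y

variable [MeasurableSpace X]

/-- `(X, ρ, μ)` is a quasi-metric measure space. -/
structure IsQMMS (ρ : X → X → ℝ) (μ : Measure X) : Prop where
  nontrivial : ∃ x y : X, x ≠ y
  quasi : IsQuasiDist ρ
  measurableSet_ball : ∀ (x : X) (r : ℝ), 0 < r → MeasurableSet (qball ρ x r)
  ball_pos : ∀ (x : X) (r : ℝ), 0 < r → 0 < μ (qball ρ x r)
  ball_lt_top : ∀ (x : X) (r : ℝ), 0 < r → μ (qball ρ x r) < ∞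

/-- Every `μ`-measurable set is contained in a Borel (measurable) set of equal measure. -/
def BorelRegular (μ : Measure X) : Prop :=
  ∀ A : Set X, ∃ B : Set X, A ⊆ B ∧ MeasurableSet B ∧ μ A = μ B

/-- `μ` is `Q`-doubling. -/
def QDoubling (ρ : X → X → ℝ) (μ : Measure X) (Q : ℝ) : Prop :=
  ∃ κ : ℝ, 0 < κ ∧ ∀ (x y : X) (r R : ℝ), 0 < r → r ≤ R →
    qball ρ x r ⊆ qball ρ y R →
    ENNReal.ofReal (κ * (r / R) ^ Q) * μ (qball ρ y R) ≤ μ (qball ρ x r)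

/-- `μ` is doubling. -/
def DoublingMeas (ρ : X → X → ℝ) (μ : Measure X) : Prop :=
  ∃ Cd : ℝ, 0 < Cd ∧ ∀ (x : X) (r : ℝ), 0 < r →
    μ (qball ρ x (2 * r)) ≤ ENNReal.ofReal Cd * μ (qball ρ x r)

/-- The measure density condition for `Ω`. -/
def MeasDensity (ρ : X → X → ℝ) (μ : Measure X) (Ω : Set X) : Prop :=
  ∃ c : ℝ, 0 < c ∧ ∀ x ∈ Ω, ∀ r : ℝ, 0 < r → r ≤ 1 →
    μ (qball ρ x r) ≤ ENNReal.ofReal c * μ (qball ρ x r ∩ Ω)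

/-- `Ω` is locally uniformly perfect with constant `lam ∈ (0,1)`. -/
def LocUnifPerfect (ρ : X → X → ℝ) (Ω : Set X) (lam : ℝ) : Prop :=
  ∀ x ∈ Ω, ∀ r : ℝ, 0 < r → r ≤ 1 → (Ω \ qball ρ x r).Nonempty →
    ((qball ρ x r ∩ Ω) \ qball ρ x (lam * r)).Nonempty

/-- The critical radius `φ^x_{Ω,ρ}(r)`. -/
def phiRad (ρ : X → X → ℝ) (μ : Measure X) (Ω : Set X) (x : X) (r : ℝ) : ℝ :=
  sSup {t : ℝ | 0 ≤ t ∧ t ≤ r ∧ μ (qball ρ x t ∩ Ω) ≤ μ (qball ρ x r ∩ Ω) / 2}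

/-- The collection `𝔻^s_ρ(u)` of fractional `s`-gradients of `u` on `Ω`. -/
def fracGrad (ρ : X → X → ℝ) (μ : Measure X) (Ω : Set X) (s : ℝ) (u : X → ℝ) :
    Set (ℤ → X → ℝ) :=
  {g | (∀ k x, 0 ≤ g k x) ∧ (∀ k, AEMeasurable (g k) (μ.restrict Ω)) ∧
    ∃ E : Set X, μ E = 0 ∧ ∀ k : ℤ, ∀ x ∈ Ω \ E, ∀ y ∈ Ω \ E,
      (2 : ℝ) ^ (-k - 1) ≤ ρ x y → ρ x y < (2 : ℝ) ^ (-k) →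
      |u x - u y| ≤ ρ x y ^ s * (g k x + g k y)}

/-- `g` is an `s`-gradient of `u` on `S`. -/
def IsSGradOn (ρ : X → X → ℝ) (μ : Measure X) (S : Set X) (s : ℝ) (u g : X → ℝ) : Prop :=
  (∀ x, 0 ≤ g x) ∧ AEMeasurable g (μ.restrict S) ∧
    ∃ E : Set X, μ E = 0 ∧ ∀ x ∈ S \ E, ∀ y ∈ S \ E,
      |u x - u y| ≤ ρ x y ^ s * (g x + g y)

/-- The `ℓ^q` norm (`0 < q ≤ ∞`) of a `ℤ`-indexed sequence in `[0,∞]`. -/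
def lqN (q : ℝ≥0∞) (a : ℤ → ℝ≥0∞) : ℝ≥0∞ :=
  if q = ∞ then ⨆ k, a k else (∑' k, a k ^ q.toReal) ^ (1 / q.toReal)

/-- The `L^p` "norm" (`0 < p < ∞`) of a `[0,∞]`-valued function. -/
def lpN (μ : Measure X) (p : ℝ) (f : X → ℝ≥0∞) : ℝ≥0∞ :=
  (∫⁻ x, f x ^ p ∂μ) ^ (1 / p)

/-- The `L^p` norm of `u : X → ℝ` over the set `Ω`. -/
def lpOn (μ : Measure X) (Ω : Set X) (p : ℝ) (u : X → ℝ) : ℝ≥0∞ :=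
  lpN (μ.restrict Ω) p fun x => ENNReal.ofReal |u x|

/-- The homogeneous Hajłasz–Triebel–Lizorkin quasi-norm `‖u‖_{Ṁ^s_{p,q}(Ω,ρ,μ)}`. -/
def MdotNorm (ρ : X → X → ℝ) (μ : Measure X) (Ω : Set X) (s p : ℝ) (q : ℝ≥0∞)
    (u : X → ℝ) : ℝ≥0∞ :=
  ⨅ g ∈ fracGrad ρ μ Ω s u,
    lpN (μ.restrict Ω) p fun x => lqN q fun k => ENNReal.ofReal (g k x)

/-- The homogeneous Hajłasz–Besov quasi-norm `‖u‖_{Ṅ^s_{p,q}(Ω,ρ,μ)}`. -/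
def NdotNorm (ρ : X → X → ℝ) (μ : Measure X) (Ω : Set X) (s p : ℝ) (q : ℝ≥0∞)
    (u : X → ℝ) : ℝ≥0∞ :=
  ⨅ g ∈ fracGrad ρ μ Ω s u,
    lqN q fun k => lpN (μ.restrict Ω) p fun x => ENNReal.ofReal (g k x)

/-- Membership in `M^s_{p,q}(Ω,ρ,μ)`. -/
def MemMspq (ρ : X → X → ℝ) (μ : Measure X) (Ω : Set X) (s p : ℝ) (q : ℝ≥0∞)
    (u : X → ℝ) : Prop :=
  AEMeasurable u (μ.restrict Ω) ∧ lpOn μ Ω p u ≠ ∞ ∧ MdotNorm ρ μ Ω s p q u ≠ ∞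

/-- Membership in `N^s_{p,q}(Ω,ρ,μ)`. -/
def MemNspq (ρ : X → X → ℝ) (μ : Measure X) (Ω : Set X) (s p : ℝ) (q : ℝ≥0∞)
    (u : X → ℝ) : Prop :=
  AEMeasurable u (μ.restrict Ω) ∧ lpOn μ Ω p u ≠ ∞ ∧ NdotNorm ρ μ Ω s p q u ≠ ∞

/-- The quasi-norm of `M^s_{p,q}(Ω,ρ,μ)`. -/
def MNorm (ρ : X → X → ℝ) (μ : Measure X) (Ω : Set X) (s p : ℝ) (q : ℝ≥0∞)
    (u : X → ℝ) : ℝ≥0∞ :=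
  MdotNorm ρ μ Ω s p q u + lpOn μ Ω p u

/-- The quasi-norm of `N^s_{p,q}(Ω,ρ,μ)`. -/
def NNorm (ρ : X → X → ℝ) (μ : Measure X) (Ω : Set X) (s p : ℝ) (q : ℝ≥0∞)
    (u : X → ℝ) : ℝ≥0∞ :=
  NdotNorm ρ μ Ω s p q u + lpOn μ Ω p u

/-- `s ⪯_q ind(X,ρ)` : there is a quasi-metric `ϱ ≈ ρ` with `s ≤ (log₂ C_ϱ)⁻¹`
(equivalently `C_ϱ ^ s ≤ 2`), where equality is permitted only when `q = ∞`. -/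
def SPrecIndex (ρ : X → X → ℝ) (s : ℝ) (q : ℝ≥0∞) : Prop :=
  ∃ ϱ : X → X → ℝ, IsQuasiDist ϱ ∧ EquivQM ρ ϱ ∧
    (Crho ϱ ^ s < 2 ∨ (q = ∞ ∧ Crho ϱ ^ s ≤ 2))

/-- `s < ind(X,ρ)` : there is a quasi-metric `ϱ ≈ ρ` with `s < (log₂ C_ϱ)⁻¹`
(equivalently `C_ϱ ^ s < 2`). -/
def SLtIndex (ρ : X → X → ℝ) (s : ℝ) : Prop :=
  ∃ ϱ : X → X → ℝ, IsQuasiDist ϱ ∧ EquivQM ρ ϱ ∧ Crho ϱ ^ s < 2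

/-- The median value `m_u(E)`. -/
def medianVal (μ : Measure X) (E : Set X) (u : X → ℝ) : ℝ :=
  sSup {θ : ℝ | μ {x ∈ E | u x < θ} ≤ μ E / 2}

/-- `f` belongs to the homogeneous Hölder space `Ċ^α(X,ρ)`. -/
def MemHolder (ρ : X → X → ℝ) (α : ℝ) (f : X → ℝ) : Prop :=
  ∃ H : ℝ, 0 ≤ H ∧ ∀ x y : X, |f x - f y| ≤ H * ρ x y ^ α

/-- The Hölder seminorm `‖f‖_{Ċ^α(X,ρ)}`. -/
def holderNorm (ρ : X → X → ℝ) (α : ℝ) (f : X → ℝ) : ℝ :=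
  sInf {H : ℝ | 0 ≤ H ∧ ∀ x y : X, |f x - f y| ≤ H * ρ x y ^ α}

/-- The sup norm of `f`. -/
def supNorm (f : X → ℝ) : ℝ := sSup (Set.range fun x => |f x|)

/-- `ρ` is a genuine metric. -/
def IsMetricDist (ρ : X → X → ℝ) : Prop :=
  (∀ x y, 0 ≤ ρ x y) ∧ (∀ x y, ρ x y = 0 ↔ x = y) ∧ (∀ x y, ρ x y = ρ y x) ∧
    (∀ x y z, ρ x y ≤ ρ x z + ρ z y)

/-- The homogeneous Hajłasz–Sobolev quasi-norm `‖u‖_{Ṁ^{1,p}(Ω,ρ,μ)}`. -/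
def M1pDotNorm (ρ : X → X → ℝ) (μ : Measure X) (Ω : Set X) (p : ℝ) (u : X → ℝ) : ℝ≥0∞ :=
  ⨅ g ∈ {g : X → ℝ | IsSGradOn ρ μ Ω 1 u g},
    lpN (μ.restrict Ω) p fun x => ENNReal.ofReal (g x)

/-- Membership in the Hajłasz–Sobolev space `M^{1,p}(Ω,ρ,μ)`. -/
def MemM1p (ρ : X → X → ℝ) (μ : Measure X) (Ω : Set X) (p : ℝ) (u : X → ℝ) : Prop :=
  AEMeasurable u (μ.restrict Ω) ∧ lpOn μ Ω p u ≠ ∞ ∧ M1pDotNorm ρ μ Ω p u ≠ ∞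

/-- The quasi-norm of `M^{1,p}(Ω,ρ,μ)`. -/
def M1pNorm (ρ : X → X → ℝ) (μ : Measure X) (Ω : Set X) (p : ℝ) (u : X → ℝ) : ℝ≥0∞ :=
  lpOn μ Ω p u + M1pDotNorm ρ μ Ω p u


/-- Frink's chain inequality for a function satisfying the `2`-max triangle inequality. -/
theorem frink_chain {α : Type*} {N : α → α → ℝ} (h0 : ∀ a b, 0 ≤ N a b)
    (h2 : ∀ a b c, N a c ≤ 2 * max (N a b) (N b c)) (n : ℕ) :
    ∀ c : ℕ → α, N (c 0) (c (n + 2)) ≤ 2 * N (c 0) (c 1) +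
      4 * ∑ i ∈ Finset.range n, N (c (i + 1)) (c (i + 2)) + 2 * N (c (n + 1)) (c (n + 2)) := by
  induction n using Nat.strong_induction_on with
  | _ n ih =>
  intro c
  have hsum : 0 ≤ ∑ i ∈ Finset.range n, N (c (i + 1)) (c (i + 2)) :=
    Finset.sum_nonneg fun i _ => h0 _ _
  have hfirst := h0 (c 0) (c 1)
  have hlast := h0 (c (n + 1)) (c (n + 2))
  by_cases hn : N (c 0) (c (n + 2)) ≤ 2 * N (c (n + 1)) (c (n + 2))
  · linarith
  obtain ⟨i, hi, hP, hnP⟩ : ∃ i ≤ n, N (c 0) (c (n + 2)) ≤ 2 * N (c i) (c (n + 2)) ∧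
      ¬ N (c 0) (c (n + 2)) ≤ 2 * N (c (i + 1)) (c (n + 2)) := by
    by_contra! hcon
    have key : ∀ i ≤ n + 1, N (c 0) (c (n + 2)) ≤ 2 * N (c i) (c (n + 2)) := by
      intro i
      induction i with
      | zero => intro _; linarith [h0 (c 0) (c (n + 2))]
      | succ i ihi => exact fun hi => hcon i (by omega) (ihi (by omega))
    exact hn (key (n + 1) le_rfl)
  have hQ : N (c 0) (c (n + 2)) ≤ 2 * N (c 0) (c (i + 1)) := by
    have := h2 (c 0) (c (i + 1)) (c (n + 2))
    rcases max_cases (N (c 0) (c (i + 1))) (N (c (i + 1)) (c (n + 2))) with h | h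
    · rwa [h.1] at this
    · rw [h.1] at this; exact absurd this hnP
  rcases i with _ | j
  · simp only [zero_add] at hQ
    linarith
  obtain ⟨l, rfl⟩ : ∃ l, n = j + 1 + l := ⟨n - (j + 1), by omega⟩
  have h₁ := ih j (by omega) c
  have h₂ := ih l (by omega) fun i => c (j + 1 + i)
  rw [Finset.sum_range_add, Finset.sum_range_succ]
  simp only [add_zero, ← add_assoc] at h₁ h₂ hP hQ ⊢
  have e : j + 1 + 1 = j + 2 := rfl
  rw [e] at hQ h₂
  linarith

/-- Metrization of a quasi-metric with constant `2`, seen from a base point. -/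
theorem exists_chain_potential {α : Type*} {N : α → α → ℝ} (h0 : ∀ a b, 0 ≤ N a b)
    (hself : ∀ a, N a a = 0) (h2 : ∀ a b c, N a c ≤ 2 * max (N a b) (N b c)) (x : α) :
    ∃ f : α → ℝ, f x = 0 ∧ (∀ z, 0 ≤ f z) ∧ (∀ z, N x z ≤ 4 * f z) ∧
      ∀ y z, f z ≤ f y + N y z := by
  let S : α → Set ℝ := fun z => {t | ∃ (n : ℕ) (c : ℕ → α), c 0 = x ∧ c n = z ∧
    t = ∑ i ∈ Finset.range n, N (c i) (c (i + 1))}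
  have hnn : ∀ z, ∀ t ∈ S z, 0 ≤ t := by
    rintro z t ⟨n, c, -, -, rfl⟩
    exact Finset.sum_nonneg fun i _ => h0 _ _
  have hbdd : ∀ z, BddBelow (S z) := fun z => ⟨0, fun t ht => hnn z t ht⟩
  have hstep : ∀ y z, ∀ t ∈ S y, t + N y z ∈ S z := by
    rintro y z t ⟨n, c, hc, hn, rfl⟩
    refine ⟨n + 1, Function.update c (n + 1) z, ?_, by simp, ?_⟩
    · rw [Function.update_of_ne (by omega), hc]
    · rw [Finset.sum_range_succ]
      congr 1
      · refine Finset.sum_congr rfl fun i hi => ?_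
        have := Finset.mem_range.1 hi
        rw [Function.update_of_ne (by omega), Function.update_of_ne (by omega)]
      · rw [Function.update_of_ne (by omega), Function.update_self, hn]
  have hx : (0 : ℝ) ∈ S x := ⟨0, fun _ => x, rfl, rfl, by simp⟩
  have hne : ∀ z, (S z).Nonempty := fun z => ⟨_, hstep x z 0 hx⟩
  refine ⟨fun z => sInf (S z), ?_, fun z => Real.sInf_nonneg (hnn z), fun z => ?_,
    fun y z => ?_⟩
  · exact le_antisymm (csInf_le (hbdd x) hx) (Real.sInf_nonneg (hnn x))
  · have : N x z / 4 ≤ sInf (S z) := by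
      refine le_csInf (hne z) ?_
      rintro t ⟨n, c, rfl, rfl, rfl⟩
      rcases n with _ | _ | n
      · simp [hself]
      · have := h0 (c 0) (c 1)
        simp only [zero_add, Finset.range_one, Finset.sum_singleton]
        linarith
      · have h := frink_chain h0 h2 n c
        rw [Finset.sum_range_succ, Finset.sum_range_succ']
        simp only [zero_add, add_assoc, Nat.reduceAdd] at h ⊢
        linarith [h0 (c 0) (c 1), h0 (c (n + 1)) (c (n + 2))]
    linarith
  · have : sInf (S z) - N y z ≤ sInf (S y) := by
      refine le_csInf (hne y) fun t ht => ?_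
      linarith [csInf_le (hbdd z) (hstep y z t ht)]
    linarith

theorem Crho_spec {α : Type*} {ϱ : α → α → ℝ} (h : IsQuasiDist ϱ) :
    1 ≤ Crho ϱ ∧ ∀ x y z, ϱ x y ≤ Crho ϱ * max (ϱ x z) (ϱ z y) := by
  obtain ⟨hnn, -, -, C₁, hC₁, htri⟩ := h
  have hne : {C : ℝ | 1 ≤ C ∧ ∀ x y z : α, ϱ x y ≤ C * max (ϱ x z) (ϱ z y)}.Nonempty :=
    ⟨C₁, hC₁, htri⟩
  refine ⟨le_csInf hne fun C hC => hC.1, fun x y z => ?_⟩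
  rcases (le_max_of_le_left (hnn x z) : 0 ≤ max (ϱ x z) (ϱ z y)).eq_or_lt with h | h
  · simpa [← h] using htri x y z
  · rw [← div_le_iff₀ h]
    exact le_csInf hne fun C hC => (div_le_iff₀ h).2 (hC.2 x y z)

/-- The index condition yields an exponent `β ≥ s` at which the quasi-metric can be metrized. -/
theorem SPrecIndex.exists_exponent {α : Type*} {ρ : α → α → ℝ} {s : ℝ} {q : ℝ≥0∞}
    (h : SPrecIndex ρ s q) :
    ∃ ϱ : α → α → ℝ, IsQuasiDist ϱ ∧ EquivQM ρ ϱ ∧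
      ∃ β, s ≤ β ∧ (q ≠ ∞ → s < β) ∧ Crho ϱ ^ β ≤ 2 := by
  obtain ⟨ϱ, hϱ, heq, hlt | ⟨hq, hle⟩⟩ := h
  · refine ⟨ϱ, hϱ, heq, ?_⟩
    have hC : Crho ϱ ≠ 0 := by linarith [(Crho_spec hϱ).1]
    have hcont : Continuous fun β : ℝ => Crho ϱ ^ β :=
      continuous_const.rpow continuous_id fun _ => Or.inl hC
    have hev : ∀ᶠ β in nhdsWithin s (Ioi s), Crho ϱ ^ β < 2 :=
      (hcont.tendsto s).eventually (gt_mem_nhds hlt) |>.filter_mono nhdsWithin_le_nhds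
    obtain ⟨β, hβ, hsβ⟩ := (hev.and self_mem_nhdsWithin).exists
    exact ⟨β, le_of_lt hsβ, fun _ => hsβ, hβ.le⟩
  · exact ⟨ϱ, hϱ, heq, s, le_rfl, fun h => absurd hq h, hle⟩

/-- Hölder bump functions on `Ω`, with constants uniform in the center and the radius. -/
theorem exists_bump {X : Type*} {ρ : X → X → ℝ} (hρ : IsQuasiDist ρ) {Ω : Set X}
    {ϱ : Ω → Ω → ℝ} (hϱ : IsQuasiDist ϱ) (heq : EquivQM (fun a b : Ω => ρ a.1 b.1) ϱ)
    {β : ℝ} (hβ : 0 < β) (hC : Crho ϱ ^ β ≤ 2) {η : ℝ} (hη : 0 < η) :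
    ∃ K : ℝ, 0 < K ∧ ∀ x ∈ Ω, ∀ r : ℝ, 0 < r → ∃ u : X → ℝ, u x = 1 ∧
      (∀ z, 0 ≤ u z ∧ u z ≤ 1) ∧ (∀ z ∉ Ω, u z = 0) ∧
      (∀ z ∈ Ω, η * r ≤ ρ x z → u z = 0) ∧
      ∀ y ∈ Ω, ∀ z ∈ Ω, |u y - u z| ≤ K * (ρ y z / r) ^ β := by
  classical
  obtain ⟨hnn, -, ⟨C₀, hC₀, hsymm⟩, -⟩ := hρ
  obtain ⟨c, hc, heq⟩ := heq
  obtain ⟨hC1, htri⟩ := Crho_spec hϱ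
  have hϱnn := hϱ.1
  have hc0 : 0 < c := by linarith
  have hup : ∀ a b : Ω, ϱ a b ≤ c * ρ a.1 b.1 := fun a b => by
    have := (heq a b).1
    rwa [inv_mul_le_iff₀ hc0] at this
  refine ⟨4 * (c * C₀) ^ β / (η / c) ^ β, by positivity, fun x hx r hr => ?_⟩
  obtain ⟨f, hfx, hf0, hf4, hf⟩ := exists_chain_potential (N := fun a b => ϱ a b ^ β)
    (fun a b => Real.rpow_nonneg (hϱnn a b) _)
    (fun a => by simp only [(hϱ.2.1 a a).2 rfl]; exact Real.zero_rpow hβ.ne')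
    (fun a b d => by
      have hm : 0 ≤ max (ϱ a b) (ϱ b d) := le_max_of_le_left (hϱnn _ _)
      calc ϱ a d ^ β ≤ (Crho ϱ * max (ϱ a b) (ϱ b d)) ^ β :=
            Real.rpow_le_rpow (hϱnn _ _) (htri a d b) hβ.le
        _ = Crho ϱ ^ β * max (ϱ a b) (ϱ b d) ^ β := Real.mul_rpow (by linarith) hm
        _ ≤ 2 * max (ϱ a b) (ϱ b d) ^ β := by gcongr
        _ = 2 * max (ϱ a b ^ β) (ϱ b d ^ β) := by
            congr 1
            rcases le_total (ϱ a b) (ϱ b d) with h | h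
            · rw [max_eq_right h, max_eq_right (Real.rpow_le_rpow (hϱnn _ _) h hβ.le)]
            · rw [max_eq_left h, max_eq_left (Real.rpow_le_rpow (hϱnn _ _) h hβ.le)])
    ⟨x, hx⟩
  set τ : ℝ := (η * r / c) ^ β / 4 with hτ
  have hτ0 : 0 < τ := by positivity
  have hN : ∀ y z : Ω, f z - f y ≤ (c * C₀) ^ β * ρ y.1 z.1 ^ β ∧
      f y - f z ≤ (c * C₀) ^ β * ρ y.1 z.1 ^ β := by
    intro y z
    rw [← Real.mul_rpow (by positivity) (hnn _ _)]
    have h1 := hf y z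
    have h2 := hf z y
    have h3 : ϱ y z ^ β ≤ (c * C₀ * ρ y.1 z.1) ^ β := by
      refine Real.rpow_le_rpow (hϱnn _ _) ((hup y z).trans ?_) hβ.le
      rw [mul_assoc]
      exact mul_le_mul_of_nonneg_left (le_mul_of_one_le_left (hnn _ _) hC₀) hc0.le
    have h4 : ϱ z y ^ β ≤ (c * C₀ * ρ y.1 z.1) ^ β := by
      refine Real.rpow_le_rpow (hϱnn _ _) ((hup z y).trans ?_) hβ.le
      rw [mul_assoc]
      exact mul_le_mul_of_nonneg_left (hsymm _ _) hc0.le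
    constructor <;> linarith
  refine ⟨fun z => if h : z ∈ Ω then max 0 (1 - f ⟨z, h⟩ / τ) else 0, ?_, ?_, ?_, ?_, ?_⟩
  · simp [hx, hfx]
  · intro z
    by_cases h : z ∈ Ω
    · simp only [h, dite_true, le_max_iff, le_refl, true_or, true_and, max_le_iff,
        zero_le_one]
      linarith [div_nonneg (hf0 ⟨z, h⟩) hτ0.le]
    · simp [h]
  · intro z h
    simp [h]
  · intro z h hz
    simp only [h, dite_true]
    refine max_eq_left ?_
    rw [sub_nonpos, one_le_div hτ0]
    have h1 : (η * r / c) ^ β ≤ ϱ ⟨x, hx⟩ ⟨z, h⟩ ^ β := by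
      refine Real.rpow_le_rpow (by positivity) ?_ hβ.le
      rw [div_le_iff₀ hc0, mul_comm (ϱ _ _)]
      exact hz.trans (heq ⟨x, hx⟩ ⟨z, h⟩).2
    linarith [hf4 ⟨z, h⟩]
  · intro y hy z hz
    simp only [hy, hz, dite_true]
    have h1 := hN ⟨y, hy⟩ ⟨z, hz⟩
    have e : 4 * (c * C₀) ^ β / (η / c) ^ β * (ρ y z / r) ^ β
        = (c * C₀) ^ β * ρ y z ^ β / τ := by
      rw [hτ, Real.div_rpow (hnn _ _) hr.le, show η * r / c = η / c * r by ring,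
        Real.mul_rpow (by positivity) hr.le]
      have : 0 < (η / c) ^ β := by positivity
      have : 0 < r ^ β := by positivity
      field_simp
    rw [e]
    calc |max 0 (1 - f ⟨y, hy⟩ / τ) - max 0 (1 - f ⟨z, hz⟩ / τ)|
        ≤ |(1 - f ⟨y, hy⟩ / τ) - (1 - f ⟨z, hz⟩ / τ)| := by
          rw [max_comm 0, max_comm 0]; exact abs_max_sub_max_le_abs _ _ _
      _ = |f ⟨z, hz⟩ - f ⟨y, hy⟩| / τ := by
          rw [← abs_of_pos hτ0, ← abs_div, abs_of_pos hτ0]; congr 1; ring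
      _ ≤ _ := by
          gcongr
          exact abs_le.2 ⟨by linarith [h1.2], h1.1⟩

theorem IsQMMS.sigmaFinite {ρ : X → X → ℝ} {μ : Measure X} (hX : IsQMMS ρ μ) :
    SigmaFinite μ := by
  obtain ⟨x, -⟩ := hX.nontrivial
  refine ⟨⟨⟨fun n => qball ρ x (n + 1), fun _ => mem_univ _,
    fun n => hX.ball_lt_top x _ (by positivity), ?_⟩⟩⟩
  refine eq_univ_of_forall fun y => mem_iUnion.2 ?_
  obtain ⟨n, hn⟩ := exists_nat_gt (ρ x y)
  exact ⟨n, show ρ x y < n + 1 by linarith⟩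

/-- A quasi-metric measure space admits countable `ε`-nets. -/
theorem IsQMMS.exists_countable_net {ρ : X → X → ℝ} {μ : Measure X} (hX : IsQMMS ρ μ)
    {ε : ℝ} (hε : 0 < ε) : ∃ D : Set X, D.Countable ∧ ∀ y, ∃ z ∈ D, ρ z y < ε := by
  have := hX.sigmaFinite
  obtain ⟨hnn, hzero, ⟨C₀, hC₀, hsymm⟩, C₁, hC₁, htri⟩ := hX.quasi
  have hC₀' : 0 < C₀ := by linarith
  have hC₁' : 0 < C₁ := by linarith
  obtain ⟨D, hD⟩ := zorn_subset {D : Set X | D.Pairwise fun a b => ε / C₀ ≤ ρ a b}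
    fun c hc hchain => ⟨⋃₀ c, (pairwise_sUnion hchain.directedOn).2 hc,
      fun s hs => subset_sUnion_of_mem hs⟩
  have hsep : D.Pairwise fun a b => ε / C₀ ≤ ρ a b := hD.prop
  refine ⟨D, ?_, fun y => ?_⟩
  · have hη : 0 < ε / C₀ / (C₁ * C₀) := by positivity
    have hcount := Measure.countable_meas_pos_of_disjoint_iUnion (μ := μ)
      (As := fun a : D => qball ρ a.1 (ε / C₀ / (C₁ * C₀)))
      (fun a => hX.measurableSet_ball _ _ hη) (fun a b hab => by
        refine Set.disjoint_left.2 fun w (ha : ρ a.1 w < _) (hb : ρ b.1 w < _) => ?_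
        have h1 := hsep a.2 b.2 fun h => hab (Subtype.ext h)
        have h2 : max (ρ a.1 w) (ρ w b.1) < C₀ * (ε / C₀ / (C₁ * C₀)) :=
          max_lt (ha.trans_le (le_mul_of_one_le_left hη.le hC₀))
            ((hsymm _ _).trans_lt (mul_lt_mul_of_pos_left hb hC₀'))
        have h3 : C₁ * max (ρ a.1 w) (ρ w b.1) < ε / C₀ := by
          calc _ < C₁ * (C₀ * (ε / C₀ / (C₁ * C₀))) := mul_lt_mul_of_pos_left h2 hC₁'
            _ = ε / C₀ := by field_simp
        linarith [htri a.1 b.1 w])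
    simp only [hX.ball_pos _ _ hη, Set.ofPred_true] at hcount
    exact countable_coe_iff.1 (countable_univ_iff.1 hcount)
  · by_contra! hcon
    have hy : y ∉ D := fun hy => by
      have := hcon y hy
      rw [(hzero y y).2 rfl] at this
      linarith
    refine hy (hD.le_of_ge (y := insert y D) ?_ (subset_insert _ _) (mem_insert _ _))
    have hle : ε / C₀ ≤ ε := div_le_self hε.le hC₀
    refine (pairwise_insert).2 ⟨hsep, fun z hz _ => ⟨?_, hle.trans (hcon z hz)⟩⟩
    rw [div_le_iff₀' hC₀']
    exact (hcon z hz).trans (hsymm y z)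

/-- Relatively open subsets of `Ω` are measurable. -/
theorem IsQMMS.measurableSet_of_relOpen {ρ : X → X → ℝ} {μ : Measure X} (hX : IsQMMS ρ μ)
    {Ω O : Set X} (hΩ : MeasurableSet Ω) (hOΩ : O ⊆ Ω)
    (hO : ∀ y ∈ O, ∃ δ > 0, ∀ z ∈ Ω, ρ y z < δ → z ∈ O) : MeasurableSet O := by
  obtain ⟨hnn, hzero, ⟨C₀, hC₀, hsymm⟩, C₁, hC₁, htri⟩ := hX.quasi
  have hC₀' : 0 < C₀ := by linarith
  have hC₁' : 0 < C₁ := by linarith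
  have hpos : ∀ n : ℕ, (0 : ℝ) < 1 / (n + 1) := fun n => by positivity
  choose D hDc hD using fun n : ℕ => hX.exists_countable_net (hpos n)
  have key : O = ⋃ n : ℕ, ⋃ z ∈ {z ∈ D n | qball ρ z (1 / (n + 1)) ∩ Ω ⊆ O},
      qball ρ z (1 / (n + 1)) ∩ Ω := by
    ext y
    simp only [mem_iUnion, exists_prop]
    refine ⟨fun hy => ?_, fun ⟨n, z, hz, hyz⟩ => hz.2 hyz⟩
    obtain ⟨δ, hδ, hyO⟩ := hO y hy
    obtain ⟨n, hn⟩ := exists_nat_one_div_lt (show 0 < δ / (C₁ * C₀) by positivity)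
    obtain ⟨z, hz, hzy⟩ := hD n y
    refine ⟨n, z, ⟨hz, fun w hw => hyO w hw.2 ?_⟩, hzy, hOΩ hy⟩
    have hzw : ρ z w < 1 / (n + 1) := hw.1
    have h1 : max (ρ y z) (ρ z w) < C₀ * (1 / (n + 1)) :=
      max_lt ((hsymm _ _).trans_lt (mul_lt_mul_of_pos_left hzy hC₀'))
        (hzw.trans_le (le_mul_of_one_le_left (hpos n).le hC₀))
    calc ρ y w ≤ C₁ * max (ρ y z) (ρ z w) := htri _ _ _
      _ < C₁ * (C₀ * (1 / (n + 1))) := mul_lt_mul_of_pos_left h1 hC₁'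
      _ = 1 / (n + 1) * (C₁ * C₀) := by ring
      _ < δ := by rwa [← lt_div_iff₀ (by positivity)]
  rw [key]
  exact MeasurableSet.iUnion fun n => MeasurableSet.biUnion ((hDc n).mono (sep_subset _ _))
    fun z _ => (hX.measurableSet_ball z _ (hpos n)).inter hΩ

theorem IsQMMS.measurable_of_continuousOn {ρ : X → X → ℝ} {μ : Measure X}
    (hX : IsQMMS ρ μ) {Ω : Set X} (hΩ : MeasurableSet Ω) {u : X → ℝ}
    (hoff : ∀ z ∉ Ω, u z = 0)
    (hu : ∀ ε > 0, ∃ δ > 0, ∀ y ∈ Ω, ∀ z ∈ Ω, ρ y z < δ → |u y - u z| < ε) :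
    Measurable u := by
  refine measurable_of_Ioi fun t => ?_
  have e : u ⁻¹' Ioi t = {z ∈ Ω | t < u z} ∪ Ωᶜ ∩ {_z | t < 0} := by
    ext z
    by_cases hz : z ∈ Ω
    · simp [hz]
    · simp [hz, hoff z hz]
  rw [e]
  refine (hX.measurableSet_of_relOpen hΩ (sep_subset _ _) ?_).union
    (hΩ.compl.inter (MeasurableSet.const _))
  rintro y ⟨hy, hty⟩
  obtain ⟨δ, hδ, h⟩ := hu (u y - t) (sub_pos.2 hty)
  exact ⟨δ, hδ, fun z hz hyz => ⟨hz, by linarith [(abs_lt.1 (h y hy z hz hyz)).2]⟩⟩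

theorem lqN_mul_const {q : ℝ≥0∞} (hq : 0 < q) (c : ℝ≥0∞) (a : ℤ → ℝ≥0∞) :
    lqN q (fun k => c * a k) = c * lqN q a := by
  unfold lqN
  split_ifs with h
  · exact (ENNReal.mul_iSup c a).symm
  · have hq' : 0 < q.toReal := ENNReal.toReal_pos hq.ne' h
    simp only [ENNReal.mul_rpow_of_nonneg _ _ hq'.le]
    rw [ENNReal.tsum_mul_left, ENNReal.mul_rpow_of_nonneg _ _ (by positivity), ← ENNReal.rpow_mul,
      mul_one_div_cancel hq'.ne', ENNReal.rpow_one]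

theorem lqN_shift (q : ℝ≥0∞) (a : ℤ → ℝ≥0∞) (m : ℤ) :
    lqN q (fun k => a (k - m)) = lqN q a := by
  unfold lqN
  split_ifs with h
  · exact (Equiv.subRight m).surjective.iSup_comp a
  · congr 1
    exact (Equiv.subRight m).tsum_eq fun k => a k ^ q.toReal

theorem lqN_geometric_ne_top {q : ℝ≥0∞} (hq : 0 < q) {M ε : ℝ} (hM : 0 ≤ M) (hε : 0 ≤ ε)
    (hqε : q ≠ ∞ → 0 < ε) :
    lqN q (fun j => ENNReal.ofReal (M * 2 ^ (-ε * |(j : ℝ)|))) ≠ ∞ := by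
  unfold lqN
  split_ifs with h
  · refine ne_top_of_le_ne_top (ENNReal.ofReal_ne_top (r := M)) (iSup_le fun j => ?_)
    refine ENNReal.ofReal_le_ofReal (mul_le_of_le_one_right hM ?_)
    exact Real.rpow_le_one_of_one_le_of_nonpos (by norm_num)
      (by nlinarith [abs_nonneg (j : ℝ)])
  · have hq' : 0 < q.toReal := ENNReal.toReal_pos hq.ne' h
    have hε' := hqε h
    refine ENNReal.rpow_ne_top_of_nonneg (by positivity) ?_
    have hgeo : Summable fun n : ℕ => M ^ q.toReal * ((2 : ℝ) ^ (-ε * q.toReal)) ^ n :=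
      (summable_geometric_of_lt_one (by positivity)
        (Real.rpow_lt_one_of_one_lt_of_neg (by norm_num) (by nlinarith))).mul_left _
    have hterm : ∀ j : ℤ, (M * 2 ^ (-ε * |(j : ℝ)|)) ^ q.toReal
        = M ^ q.toReal * ((2 : ℝ) ^ (-ε * q.toReal)) ^ j.natAbs := fun j => by
      rw [Real.mul_rpow hM (by positivity), ← Real.rpow_mul (by norm_num),
        ← Real.rpow_natCast, ← Real.rpow_mul (by norm_num), Nat.cast_natAbs, Int.cast_abs]
      ring_nf
    have hsum : Summable fun j : ℤ => (M * 2 ^ (-ε * |(j : ℝ)|)) ^ q.toReal := by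
      simp only [hterm]
      exact Summable.of_nat_of_neg (by simpa using hgeo) (by simpa using hgeo)
    simp only [ENNReal.ofReal_rpow_of_nonneg
      (mul_nonneg hM (Real.rpow_nonneg zero_le_two _)) hq'.le]
    rw [← ENNReal.ofReal_tsum_of_nonneg (fun j => by positivity) hsum]
    exact ENNReal.ofReal_ne_top

theorem lqN_zero {q : ℝ≥0∞} (hq : 0 < q) : lqN q (fun _ => 0) = 0 := by
  simpa using lqN_mul_const hq 0 fun _ => 0

theorem lpN_lqN_indicator (μ : Measure X) {p : ℝ} (hp : 0 < p) {q : ℝ≥0∞} (hq : 0 < q)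
    {A : Set X} (hA : MeasurableSet A) (a : ℤ → ℝ) :
    lpN μ p (fun x => lqN q fun k => ENNReal.ofReal (A.indicator (fun _ => a k) x)) =
      lqN q (fun k => ENNReal.ofReal (a k)) * μ A ^ (1 / p) := by
  have e : ∀ x, (lqN q fun k => ENNReal.ofReal (A.indicator (fun _ => a k) x)) ^ p =
      A.indicator (fun _ => lqN q (fun k => ENNReal.ofReal (a k)) ^ p) x := fun x => by
    by_cases hx : x ∈ A
    · simp [hx]
    · simp [hx, lqN_zero hq, hp]
  unfold lpN
  simp only [e]
  rw [lintegral_indicator_const hA, ENNReal.mul_rpow_of_nonneg _ _ (by positivity),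
    ← ENNReal.rpow_mul, mul_one_div_cancel hp.ne', ENNReal.rpow_one]

/-- The quasi-norm of a bump function at scale `r` is controlled by `r ^ (-s)` times the
measure of a set carrying it. -/
theorem exists_MdotNorm_le (ρ : X → X → ℝ) (μ : Measure X) (Ω : Set X)
    {s p β K : ℝ} {q : ℝ≥0∞} (hs : 0 < s) (hp : 0 < p) (hq : 0 < q) (hK : 0 < K) (hsβ : s ≤ β)
    (hqβ : q ≠ ∞ → s < β) :
    ∃ C : ℝ, 0 < C ∧ ∀ (A : Set X) (r : ℝ) (u : X → ℝ), MeasurableSet A → 0 < r →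
      (∀ z, 0 ≤ u z ∧ u z ≤ 1) → (∀ z ∈ Ω, z ∉ A → u z = 0) →
      (∀ y ∈ Ω, ∀ z ∈ Ω, |u y - u z| ≤ K * (ρ y z / r) ^ β) →
      MdotNorm ρ μ Ω s p q u ≤ ENNReal.ofReal (C * r ^ (-s)) * μ (A ∩ Ω) ^ (1 / p) := by
  set ε := min s (β - s) with hε
  set M := max ((2 : ℝ) ^ s) K with hM
  have hε0 : 0 ≤ ε := le_min hs.le (by linarith)
  have hM0 : 0 < M := lt_max_of_lt_right hK
  set b : ℤ → ℝ := fun j => M * 2 ^ (-ε * |(j : ℝ)|) with hb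
  have hfin : lqN q (fun j => ENNReal.ofReal (b j)) ≠ ∞ :=
    lqN_geometric_ne_top hq hM0.le hε0 fun h => lt_min hs (by linarith [hqβ h])
  set L := (lqN q fun j => ENNReal.ofReal (b j)).toReal with hL
  have hL0 : 0 ≤ L := ENNReal.toReal_nonneg
  refine ⟨2 ^ s * (L + 1), by positivity, fun A r u hA hr hu hoff hhol => ?_⟩
  obtain ⟨m, hm1, hm2⟩ := exists_mem_Ico_zpow (inv_pos.2 hr) one_lt_two
  set n := m + 1 with hn
  have hrn : r⁻¹ ≤ (2 : ℝ) ^ (n : ℝ) := by rw [Real.rpow_intCast]; exact hm2.le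
  have hnr : (2 : ℝ) ^ (n : ℝ) ≤ 2 * r⁻¹ := by
    rw [Real.rpow_intCast, hn, zpow_add_one₀ two_ne_zero]; linarith
  set a : ℤ → ℝ := fun k => 2 ^ (s * n) * b (k - n) with ha
  have ha0 : ∀ k, 0 ≤ a k := fun k => by simp only [ha, hb]; positivity
  have hloc : ∀ k : ℤ, ∀ y ∈ Ω, ∀ z ∈ Ω, (2 : ℝ) ^ (-k - 1) ≤ ρ y z →
      ρ y z < (2 : ℝ) ^ (-k) → |u y - u z| ≤ ρ y z ^ s * a k := by
    intro k y hy z hz hlo hhi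
    set t := ρ y z
    have hlo' : (2 : ℝ) ^ (-(k : ℝ) - 1) ≤ t := by
      have : (-(k : ℝ) - 1) = ((-k - 1 : ℤ) : ℝ) := by push_cast; ring
      rwa [this, Real.rpow_intCast]
    have hhi' : t ≤ (2 : ℝ) ^ (-(k : ℝ)) := by
      have : (-(k : ℝ)) = ((-k : ℤ) : ℝ) := by push_cast; ring
      rw [this, Real.rpow_intCast]; exact hhi.le
    have ht : 0 < t := lt_of_lt_of_le (by positivity) hlo'
    simp only [ha, hb]
    push_cast
    rcases le_total (k : ℝ) n with hkn | hkn
    · rw [abs_of_nonpos (by linarith : (k : ℝ) - n ≤ 0)]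
      have h1 : |u y - u z| ≤ 1 := by
        rw [abs_le]; constructor <;> linarith [hu y, hu z, (hu y).1, (hu z).1, (hu y).2, (hu z).2]
      refine h1.trans ?_
      calc (1 : ℝ) ≤ 2 ^ (((n : ℝ) - k) * (s - ε)) :=
            Real.one_le_rpow one_le_two
              (mul_nonneg (by linarith) (by linarith [min_le_left s (β - s)]))
        _ = (2 ^ (-(k : ℝ) - 1)) ^ s * (2 ^ (s * n) * (2 ^ s * 2 ^ (-ε * -((k : ℝ) - n)))) := by
            rw [← Real.rpow_mul zero_le_two, ← Real.rpow_add two_pos, ← Real.rpow_add two_pos,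
              ← Real.rpow_add two_pos]
            ring_nf
        _ ≤ _ := by
            gcongr
            exact le_max_left _ _
    · rw [abs_of_nonneg (by linarith : 0 ≤ (k : ℝ) - n)]
      calc |u y - u z| ≤ K * (t * r⁻¹) ^ β := hhol y hy z hz
        _ = K * (t ^ s * t ^ (β - s) * r⁻¹ ^ β) := by
            rw [Real.mul_rpow ht.le (by positivity), ← Real.rpow_add ht]; ring_nf
        _ ≤ M * (t ^ s * (2 ^ (-(k : ℝ))) ^ (β - s) * (2 ^ (n : ℝ)) ^ β) := by
            have : 0 ≤ β - s := by linarith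
            have : 0 ≤ β := by linarith
            gcongr
            exact le_max_right _ _
        _ = t ^ s * M * 2 ^ (s * n - ((k : ℝ) - n) * (β - s)) := by
            rw [← Real.rpow_mul zero_le_two, ← Real.rpow_mul zero_le_two, mul_assoc (t ^ s),
              ← Real.rpow_add two_pos]
            ring_nf
        _ ≤ t ^ s * M * 2 ^ (s * n + -ε * ((k : ℝ) - n)) := by
            gcongr
            · exact one_le_two
            · nlinarith [min_le_right s (β - s)]
        _ = _ := by
            rw [Real.rpow_add two_pos]; ring
  have hg : (fun k => A.indicator fun _ => a k) ∈ fracGrad ρ μ Ω s u := by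
    have hind0 : ∀ k z, 0 ≤ A.indicator (fun _ => a k) z :=
      fun k z => indicator_nonneg (fun _ _ => ha0 k) z
    refine ⟨hind0, fun k => (measurable_const.indicator hA).aemeasurable, ∅, measure_empty,
      fun k y hy z hz hlo hhi => ?_⟩
    rw [sdiff_empty] at hy hz
    beta_reduce
    have ht : 0 < ρ y z := lt_of_lt_of_le (by positivity) hlo
    have hts : 0 ≤ ρ y z ^ s := by positivity
    by_cases h : y ∈ A ∨ z ∈ A
    · refine (hloc k y hy z hz hlo hhi).trans (mul_le_mul_of_nonneg_left ?_ hts)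
      rcases h with h | h
      · rw [indicator_of_mem h]; linarith [hind0 k z]
      · rw [indicator_of_mem h]; linarith [hind0 k y]
    · push Not at h
      rw [hoff y hy h.1, hoff z hz h.2, sub_zero, abs_zero]
      exact mul_nonneg hts (add_nonneg (hind0 k y) (hind0 k z))
  refine (iInf₂_le _ hg).trans ?_
  rw [lpN_lqN_indicator _ hp hq hA, Measure.restrict_apply hA]
  gcongr
  have hmul : ∀ k, ENNReal.ofReal (a k)
      = ENNReal.ofReal (2 ^ (s * n)) * ENNReal.ofReal (b (k - n)) := fun k =>
    ENNReal.ofReal_mul (by positivity)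
  simp only [hmul]
  rw [lqN_mul_const hq, lqN_shift q (fun j => ENNReal.ofReal (b j)), ← ENNReal.ofReal_toReal hfin,
    ← ENNReal.ofReal_mul (by positivity)]
  refine ENNReal.ofReal_le_ofReal ?_
  calc (2 : ℝ) ^ (s * n) * L = (2 ^ (n : ℝ)) ^ s * L := by
        rw [← Real.rpow_mul zero_le_two, mul_comm s]
    _ ≤ (2 * r⁻¹) ^ s * (L + 1) := by gcongr; linarith
    _ = 2 ^ s * (L + 1) * r ^ (-s) := by
        rw [Real.mul_rpow zero_le_two (by positivity), Real.inv_rpow hr.le, Real.rpow_neg hr.le]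
        ring

/-- The measure density condition at the scales at which `Ω` is contained in a ball. -/
theorem IsQMMS.exists_density_of_subset_qball {ρ : X → X → ℝ} {μ : Measure X}
    (hX : IsQMMS ρ μ) {Ω : Set X}
    (hΩpos : ∀ x ∈ Ω, ∀ r : ℝ, 0 < r → r ≤ 1 → 0 < μ (qball ρ x r ∩ Ω)) :
    ∃ c : ℝ, ∀ x ∈ Ω, ∀ r : ℝ, 0 < r → r ≤ 1 → Ω ⊆ qball ρ x r →
      μ (qball ρ x r) ≤ ENNReal.ofReal c * μ (qball ρ x r ∩ Ω) := by
  by_cases h : ∃ x₀ ∈ Ω, ∃ R : ℝ, 0 < R ∧ R ≤ 1 ∧ Ω ⊆ qball ρ x₀ R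
  · obtain ⟨x₀, hx₀, R, hR, hR1, hsub⟩ := h
    obtain ⟨-, -, -, C₁, hC₁, htri⟩ := hX.quasi
    set S := C₁ * max R 1 with hS
    have hS0 : 0 < S := by positivity
    have hΩ : 0 < μ Ω := (hΩpos x₀ hx₀ R hR hR1).trans_le (measure_mono inter_subset_right)
    have hfin : μ (qball ρ x₀ S) / μ Ω ≠ ∞ :=
      ENNReal.div_ne_top (hX.ball_lt_top _ _ hS0).ne hΩ.ne'
    have hΩtop : μ Ω ≠ ∞ := ((measure_mono hsub).trans_lt (hX.ball_lt_top _ _ hR)).ne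
    refine ⟨(μ (qball ρ x₀ S) / μ Ω).toReal, fun x hx r _ hr hsub' => ?_⟩
    rw [inter_eq_right.2 hsub', ENNReal.ofReal_toReal hfin,
      ENNReal.div_mul_cancel hΩ.ne' hΩtop]
    refine measure_mono fun y (hy : ρ x y < r) => ?_
    refine (htri x₀ y x).trans_lt (mul_lt_mul_of_pos_left ?_ (by linarith))
    exact max_lt_max (hsub hx) (hy.trans_le hr)
  · exact ⟨0, fun x hx r hr0 hr1 hsub => absurd ⟨x, hx, r, hr0, hr1, hsub⟩ h⟩

theorem exists_mem_of_ae_restrict {μ : Measure X} {Ω A : Set X} (hΩ : MeasurableSet Ω)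
    {P : X → Prop} (hP : ∀ᵐ x ∂μ.restrict Ω, P x) (hA : 0 < μ (A ∩ Ω)) :
    ∃ x ∈ A ∩ Ω, P x := by
  by_contra! hcon
  rw [ae_restrict_iff' hΩ] at hP
  refine hA.ne' (measure_mono_null (fun x hx => ?_) (ae_iff.1 hP))
  exact fun h => hcon x hx (h hx.2)

/-- Comparing the Hölder bound with the size of a bump function bounds the measure of a ball. -/
theorem measure_le_of_holder_bump {s p Q r t D CH C m w M : ℝ} (hr : 0 < r) (hp : 0 < p)
    (hQs : 0 ≤ s - Q / p) (hCH : 0 < CH) (hD : 0 < D) (hC : 0 < C) (hm : 0 < m) (hw : 0 ≤ w)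
    (ht : 0 ≤ t) (htD : t ≤ D * r) (hM0 : 0 ≤ M) (hM : M ≤ C * r ^ (-s) * w ^ (1 / p))
    (h : 1 / 2 ≤ CH * t ^ (s - Q / p) * (r ^ (Q / p) / m ^ (1 / p)) * M) :
    m ≤ (2 * CH * D ^ (s - Q / p) * C) ^ p * w := by
  have hG : 0 < 2 * CH * D ^ (s - Q / p) * C := by positivity
  have hrs : r ^ (s - Q / p) * r ^ (Q / p) * r ^ (-s) = 1 := by
    rw [← Real.rpow_add hr, ← Real.rpow_add hr, ← Real.rpow_zero r]; congr 1; ring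
  have hmp : 0 < m ^ (1 / p) := by positivity
  have h1 : 1 / 2 ≤ CH * D ^ (s - Q / p) * C * w ^ (1 / p) / m ^ (1 / p) := by
    calc 1 / 2 ≤ CH * t ^ (s - Q / p) * (r ^ (Q / p) / m ^ (1 / p)) * M := h
      _ ≤ CH * (D * r) ^ (s - Q / p) * (r ^ (Q / p) / m ^ (1 / p)) *
          (C * r ^ (-s) * w ^ (1 / p)) := by gcongr
      _ = CH * D ^ (s - Q / p) * C * w ^ (1 / p) / m ^ (1 / p) *
          (r ^ (s - Q / p) * r ^ (Q / p) * r ^ (-s)) := by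
        rw [Real.mul_rpow hD.le hr.le]; ring
      _ = _ := by rw [hrs, mul_one]
  have h2 : m ^ (1 / p) ≤ 2 * CH * D ^ (s - Q / p) * C * w ^ (1 / p) := by
    rw [le_div_iff₀ hmp] at h1; linarith
  have h3 := Real.rpow_le_rpow hmp.le h2 hp.le
  rwa [← Real.rpow_mul hm.le, one_div_mul_cancel hp.ne', Real.rpow_one,
    Real.mul_rpow hG.le (by positivity), ← Real.rpow_mul hw, one_div_mul_cancel hp.ne',
    Real.rpow_one] at h3

/-- Theorem 4.4 ((g) ⟹ (a)): a local Hölder embedding for `Ṁ^s_{p,q}(Ω)` with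
`s ⪯_q ind(Ω,ρ)` and `p ∈ (Q/s,∞)` forces the measure density condition. -/
theorem M_holder_implies_measure_density
    {X : Type*} [MeasurableSpace X] (ρ : X → X → ℝ) (μ : Measure X)
    (hX : IsQMMS ρ μ) (hreg : BorelRegular μ)
    (Q : ℝ) (hQ : 0 < Q) (hdoub : QDoubling ρ μ Q)
    (Ω : Set X) (hΩmeas : MeasurableSet Ω)
    (hΩpos : ∀ x ∈ Ω, ∀ r : ℝ, 0 < r → r ≤ 1 → 0 < μ (qball ρ x r ∩ Ω))
    (hperf : ∃ lam : ℝ, 0 < lam ∧ lam < 1 ∧ LocUnifPerfect ρ Ω lam)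
    (s p : ℝ) (q : ℝ≥0∞) (hs : 0 < s) (hp : Q / s < p) (hq : 0 < q)
    (hind : SPrecIndex (fun a b : Ω => ρ a.1 b.1) s q)
    (CH : ℝ) (hCH : 0 < CH)
    (hhold : ∀ x₀ ∈ Ω, ∀ R₀ : ℝ, 0 < R₀ → R₀ ≤ 1 →
      ∀ u : X → ℝ, AEMeasurable u (μ.restrict Ω) → MdotNorm ρ μ Ω s p q u ≠ ∞ →
        ∃ v : X → ℝ, (∀ᵐ x ∂μ.restrict Ω, v x = u x) ∧
          ∀ x ∈ qball ρ x₀ R₀ ∩ Ω, ∀ y ∈ qball ρ x₀ R₀ ∩ Ω,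
            |v x - v y| ≤ CH * ρ x y ^ (s - Q / p) *
              (R₀ ^ (Q / p) / (μ (qball ρ x₀ R₀)).toReal ^ (1 / p)) *
              (MdotNorm ρ μ Ω s p q u).toReal) :
    MeasDensity ρ μ Ω := by
  obtain ⟨hnn, hzero, ⟨C₀, hC₀, hsymm⟩, C₁, hC₁, htri⟩ := id hX.quasi
  obtain ⟨lam, hlam0, hlam1, hperf⟩ := hperf
  have hC₀' : 0 < C₀ := by linarith
  have hC₁' : 0 < C₁ := by linarith
  have hp0 : 0 < p := (by positivity : 0 < Q / s).trans hp
  have hQs : 0 ≤ s - Q / p := by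
    rw [div_lt_iff₀ hs] at hp
    rw [sub_nonneg, div_le_iff₀ hp0]
    linarith
  obtain ⟨ϱ, hϱ, heq, β, hsβ, hqβ, hCβ⟩ := hind.exists_exponent
  have hβ : 0 < β := hs.trans_le hsβ
  have hη : 0 < lam / C₁ := by positivity
  have hη1 : lam / C₁ ≤ 1 := (div_le_one hC₁').2 (by linarith)
  obtain ⟨K, hK, hbump⟩ := exists_bump hX.quasi hϱ heq hβ hCβ hη
  obtain ⟨C, hC, hnorm⟩ := exists_MdotNorm_le ρ μ Ω hs hp0 hq hK hsβ hqβ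
  obtain ⟨c₁, hc₁⟩ := hX.exists_density_of_subset_qball hΩpos
  set G := (2 * CH * (C₁ * C₀) ^ (s - Q / p) * C) ^ p with hG
  have hG0 : 0 < G := by positivity
  refine ⟨max c₁ G, lt_max_of_lt_right hG0, fun x hx r hr hr1 => ?_⟩
  by_cases hsub : Ω ⊆ qball ρ x r
  · refine (hc₁ x hx r hr hr1 hsub).trans ?_
    gcongr
    exact le_max_left _ _
  have hrC : r / C₁ ≤ r := div_le_self hr.le hC₁
  have hrC0 : 0 < r / C₁ := by positivity
  have hne : (Ω \ qball ρ x (r / C₁)).Nonempty := by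
    obtain ⟨z, hz, hzr⟩ := not_subset.1 hsub
    exact ⟨z, hz, fun h => hzr (lt_of_lt_of_le h hrC)⟩
  obtain ⟨y, ⟨hyr, hyΩ⟩, hyl⟩ := hperf x hx (r / C₁) hrC0 (hrC.trans hr1) hne
  have hyl : lam / C₁ * r ≤ ρ x y := by
    rw [div_mul_eq_mul_div, mul_div_assoc]; exact not_lt.1 hyl
  obtain ⟨u, hux, hu01, huoff, huη, huhol⟩ := hbump x hx r hr
  have hucont : ∀ ε > 0, ∃ δ > 0, ∀ a ∈ Ω, ∀ b ∈ Ω, ρ a b < δ → |u a - u b| < ε := by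
    intro ε hε
    refine ⟨r * (ε / K) ^ (1 / β), by positivity, fun a ha b hb hab => ?_⟩
    refine (huhol a ha b hb).trans_lt ?_
    rw [← lt_div_iff₀' hK]
    calc (ρ a b / r) ^ β < ((ε / K) ^ (1 / β)) ^ β := by
          refine Real.rpow_lt_rpow (div_nonneg (hnn _ _) hr.le) ?_ hβ
          rwa [div_lt_iff₀' hr]
      _ = ε / K := by
          rw [← Real.rpow_mul (by positivity), one_div_mul_cancel hβ.ne', Real.rpow_one]
  have humeas : Measurable u := hX.measurable_of_continuousOn hΩmeas huoff hucont
  have hball := hX.measurableSet_ball x r hr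
  have hMle := hnorm (qball ρ x r) r u hball hr hu01
    (fun z hz hzr => huη z hz ((mul_le_of_le_one_left hr.le hη1).trans (not_lt.1 hzr))) huhol
  have hwtop : μ (qball ρ x r ∩ Ω) ≠ ∞ :=
    ((measure_mono inter_subset_left).trans_lt (hX.ball_lt_top x r hr)).ne
  have hrhs : ENNReal.ofReal (C * r ^ (-s)) * μ (qball ρ x r ∩ Ω) ^ (1 / p) ≠ ∞ :=
    ENNReal.mul_ne_top ENNReal.ofReal_ne_top (ENNReal.rpow_ne_top_of_nonneg (by positivity) hwtop)
  obtain ⟨v, hvu, hv⟩ := hhold x hx r hr hr1 u humeas.aemeasurable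
    (ne_top_of_le_ne_top hrhs hMle)
  obtain ⟨δ, hδ, hδu⟩ := hucont (1 / 4) (by norm_num)
  have hδ' : 0 < min δ (r / C₁) := lt_min hδ hrC0
  have hδ1 : min δ (r / C₁) ≤ 1 := (min_le_right _ _).trans (hrC.trans hr1)
  obtain ⟨x', ⟨hx'δ, hx'Ω⟩, hvx'⟩ := exists_mem_of_ae_restrict hΩmeas hvu
    (hΩpos x hx _ hδ' hδ1)
  obtain ⟨y', ⟨hy'δ, hy'Ω⟩, hvy'⟩ := exists_mem_of_ae_restrict hΩmeas hvu
    (hΩpos y hyΩ _ hδ' hδ1)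
  have hx'r : ρ x x' < r := lt_of_lt_of_le hx'δ ((min_le_right _ _).trans hrC)
  have hy'r : ρ x y' < r := by
    calc ρ x y' ≤ C₁ * max (ρ x y) (ρ y y') := htri _ _ _
      _ < C₁ * (r / C₁) := by
        gcongr
        exact max_lt hyr (lt_of_lt_of_le hy'δ (min_le_right _ _))
      _ = r := mul_div_cancel₀ r hC₁'.ne'
  have hdist : ρ x' y' ≤ C₁ * C₀ * r := by
    calc ρ x' y' ≤ C₁ * max (ρ x' x) (ρ x y') := htri _ _ _
      _ ≤ C₁ * (C₀ * r) := by
        gcongr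
        refine max_le ((hsymm x x').trans (by gcongr)) (hy'r.le.trans ?_)
        exact le_mul_of_one_le_left hr.le hC₀
      _ = _ := by ring
  have hgap : 1 / 2 ≤ |v x' - v y'| := by
    have h1 := hδu x hx x' hx'Ω (lt_of_lt_of_le hx'δ (min_le_left _ _))
    have h2 := hδu y hyΩ y' hy'Ω (lt_of_lt_of_le hy'δ (min_le_left _ _))
    rw [hux] at h1
    rw [huη y hyΩ hyl] at h2
    rw [hvx', hvy']
    refine le_trans ?_ (le_abs_self _)
    linarith [(abs_lt.1 h1).2, (abs_lt.1 h2).1]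
  have hMreal : (MdotNorm ρ μ Ω s p q u).toReal ≤
      C * r ^ (-s) * (μ (qball ρ x r ∩ Ω)).toReal ^ (1 / p) := by
    refine (ENNReal.toReal_mono hrhs hMle).trans_eq ?_
    rw [ENNReal.toReal_mul, ENNReal.toReal_ofReal (by positivity), ENNReal.toReal_rpow]
  have hfinal := measure_le_of_holder_bump hr hp0 hQs hCH (by positivity) hC
    (ENNReal.toReal_pos (hX.ball_pos x r hr).ne' (hX.ball_lt_top x r hr).ne)
    ENNReal.toReal_nonneg (hnn x' y') hdist ENNReal.toReal_nonneg hMreal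
    (hgap.trans (hv x' ⟨hx'r, hx'Ω⟩ y' ⟨hy'r, hy'Ω⟩))
  calc μ (qball ρ x r) = ENNReal.ofReal (μ (qball ρ x r)).toReal :=
        (ENNReal.ofReal_toReal (hX.ball_lt_top x r hr).ne).symm
    _ ≤ ENNReal.ofReal (G * (μ (qball ρ x r ∩ Ω)).toReal) := ENNReal.ofReal_le_ofReal hfinal
    _ = ENNReal.ofReal G * μ (qball ρ x r ∩ Ω) := by
        rw [ENNReal.ofReal_mul hG0.le, ENNReal.ofReal_toReal hwtop]
    _ ≤ _ := by
        gcongr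
        exact le_max_right _ _

end HajlaszPaper
end
end

section
/- Let (X,ρ,μ) be a doubling metric measure space (ρ a genuine metric) in which μ is Borel regular and Q-doubling for some Q ∈ (0,∞), and let Ω ⊂ X be a μ-measurable locally uniformly perfect set. Then the following are equivalent: (a) Ω satisfies the measure density condition; (b) for some (equivalently, for every) p ∈ (0,∞), Ω is an M^{1,p}-extension domain, i.e. there exists C > 0 such that every u ∈ M^{1,p}(Ω,ρ,μ) admits ũ ∈ M^{1,p}(X,ρ,μ) with ũ|_Ω = u μ-almost everywhere and ‖ũ‖_{M^{1,p}(X,ρ,μ)} ≤ C ‖u‖_{M^{1,p}(Ω,ρ,μ)}. -/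
open MeasureTheory ENNReal Set

noncomputable section

namespace HajlaszPaper

variable {X : Type*}

variable [MeasurableSpace X]

/-- `Ω` is an `M^{1,p}`-extension domain. -/
def M1pExtDomain {X : Type*} [MeasurableSpace X] (ρ : X → X → ℝ) (μ : Measure X)
    (Ω : Set X) (p : ℝ) : Prop :=
  ∃ C : ℝ, 0 < C ∧ ∀ u : X → ℝ, MemM1p ρ μ Ω p u →
    ∃ v : X → ℝ, MemM1p ρ μ Set.univ p v ∧ (∀ᵐ x ∂μ.restrict Ω, v x = u x) ∧
      M1pNorm ρ μ Set.univ p v ≤ ENNReal.ofReal C * M1pNorm ρ μ Ω p u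

lemma exists_lipschitz_value {Y : Type*} [MetricSpace Y] (S : Set Y) (u h : Y → ℝ)
    (hgrad : ∀ x ∈ S, ∀ y ∈ S, |u x - u y| ≤ dist x y * (h x + h y)) (x : Y) {P : ℝ}
    (hP : 0 ≤ P) :
    ∃ m : ℝ, ∀ y ∈ S, h y ≤ P → |m - u y| ≤ 2 * P * dist x y := by
  have hL : LipschitzOnWith (2 * P).toNNReal u {y ∈ S | h y ≤ P} := by
    refine LipschitzOnWith.of_dist_le_mul fun a ha b hb => ?_
    rw [Real.dist_eq, Real.coe_toNNReal _ (by positivity)]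
    have := hgrad a ha.1 b hb.1
    have h1 := ha.2
    have h2 := hb.2
    nlinarith [dist_nonneg (x := a) (y := b)]
  obtain ⟨w, hw, he⟩ := hL.extend_real
  refine ⟨w x, fun y hy hyP => ?_⟩
  have := hw.dist_le_mul x y
  rw [Real.dist_eq, Real.coe_toNNReal _ (by positivity)] at this
  rwa [he ⟨hy, hyP⟩]

/-- A function with a pointwise gradient `h` on `S` extends to a function with gradient a multiple
of `G` near `S`, provided that every ball of radius `r ≤ 1` centered at distance less than `r / 2`
from `S` contains a point `y` of `S` at which `h y` is at most the infimum of `G` over the ball. -/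
lemma exists_local_extension {Y : Type*} [MetricSpace Y] (S : Set Y) (u h G : Y → ℝ)
    (hG : ∀ x, 0 ≤ G x) (hu : ∀ x ∈ S, |u x| ≤ h x)
    (hgrad : ∀ x ∈ S, ∀ y ∈ S, |u x - u y| ≤ dist x y * (h x + h y))
    (hhG : ∀ x ∈ S, h x ≤ G x)
    (hsel : ∀ x r, Metric.infDist x S < r / 2 → r ≤ 1 →
      ∃ y ∈ S, dist x y < r ∧ ∀ w, dist x w < r → h y ≤ G w) :
    ∃ v : Y → ℝ, (∀ x ∈ S, v x = u x) ∧
      (∀ x, Metric.infDist x S < 1 / 20 → |v x| ≤ 20 * G x) ∧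
      ∀ x x', Metric.infDist x S < 1 / 20 → Metric.infDist x' S < 1 / 20 →
        |v x - v x'| ≤ 40000 * dist x x' * (G x + G x') := by
  set δ : Y → ℝ := fun x => Metric.infDist x S with hδ
  have hδ0 : ∀ x, 0 ≤ δ x := fun x => Metric.infDist_nonneg
  have hδd : ∀ x y, δ x ≤ δ y + dist x y := fun x y => Metric.infDist_le_infDist_add_dist
  have bdd : ∀ (x : Y) (s : ℝ), BddBelow (range fun w : Metric.closedBall x s => G w.1) := fun x s =>
    ⟨0, by rintro _ ⟨w, rfl⟩; exact hG _⟩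
  have ne : ∀ (x : Y) (s : ℝ), 0 ≤ s → Nonempty (Metric.closedBall x s) := fun x s hs =>
    ⟨⟨x, Metric.mem_closedBall_self hs⟩⟩
  set P : Y → ℝ := fun x => ⨅ w : Metric.closedBall x (δ x), G w.1 with hPdef
  set R : Y → ℝ := fun x => ⨅ w : Metric.closedBall x (δ x / 4), G w.1 with hRdef
  have P_le : ∀ x w, dist x w ≤ δ x → P x ≤ G w := fun x w hw =>
    ciInf_le (bdd x (δ x)) ⟨w, by rwa [Metric.mem_closedBall, dist_comm]⟩
  have R_le : ∀ x w, dist x w ≤ δ x / 4 → R x ≤ G w := fun x w hw =>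
    ciInf_le (bdd x (δ x / 4)) ⟨w, by rwa [Metric.mem_closedBall, dist_comm]⟩
  have le_P : ∀ x c, (∀ w, dist x w ≤ δ x → c ≤ G w) → c ≤ P x := fun x c hc => by
    have := ne x (δ x) (hδ0 x)
    exact le_ciInf fun w => hc w (by rw [dist_comm]; exact w.2)
  have le_R : ∀ x c, (∀ w, dist x w ≤ δ x / 4 → c ≤ G w) → c ≤ R x := fun x c hc => by
    have := ne x (δ x / 4) (by have := hδ0 x; positivity)
    exact le_ciInf fun w => hc w (by rw [dist_comm]; exact w.2)
  have P0 : ∀ x, 0 ≤ P x := fun x => le_P x 0 fun w _ => hG w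
  have R0 : ∀ x, 0 ≤ R x := fun x => le_R x 0 fun w _ => hG w
  choose m hm using fun x => exists_lipschitz_value S u h hgrad x (P0 x)
  -- nearby values of `m`
  have near : ∀ x z, δ x < 1 / 8 → dist x z ≤ δ x / 4 → |m x - m z| ≤ 17 * δ x * R z := by
    intro x z hx hxz
    rcases (hδ0 x).eq_or_lt with h0 | h0
    · have : x = z := dist_le_zero.1 (by rw [← h0] at hxz; linarith)
      subst this
      simp [← h0]
    have e1 := hδd x z
    have e2 := hδd z x
    rw [dist_comm z x] at e2
    obtain ⟨y, hyS, hxy, hy⟩ := hsel x (4 * δ x) (by simp only [hδ] at h0 ⊢; linarith) (by linarith)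
    have hPx : h y ≤ P x := le_P x _ fun w hw => hy w (by linarith)
    have hPz : h y ≤ P z := le_P z _ fun w hw => hy w (by
      linarith [dist_triangle x z w])
    have a1 := hm x y hyS hPx
    have a2 := hm z y hyS hPz
    have b1 : P x ≤ R z := le_R z _ fun w hw => P_le x w (by linarith [dist_triangle x z w])
    have b2 : P z ≤ R z := le_R z _ fun w hw => P_le z w (by linarith [hδ0 z])
    have c1 : dist z y ≤ 17 / 4 * δ x := by
      linarith [dist_triangle z x y, dist_comm z x]
    have d1 : 2 * P x * dist x y ≤ 2 * R z * (4 * δ x) := by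
      have := R0 z
      gcongr
    have d2 : 2 * P z * dist z y ≤ 2 * R z * (17 / 4 * δ x) := by
      have := R0 z
      gcongr
    rw [abs_le] at a1 a2 ⊢
    have := mul_nonneg (R0 z) h0.le
    constructor <;> nlinarith
  set Φ : Y → Y → ℝ := fun x z => m z + 272 * R z * dist x z with hΦ
  have Φself : ∀ x, Φ x x = m x := fun x => by simp [hΦ]
  set v : Y → ℝ := fun x => ⨅ z : Metric.closedBall x (δ x / 8), Φ x z.1 with hv
  have Φlow : ∀ x z, δ x < 1 / 8 → dist x z ≤ δ x / 8 → m x - 17 * δ x * G x ≤ Φ x z := by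
    intro x z hx hxz
    have e1 := hδd x z
    have := near x z hx (by linarith [hδ0 x])
    have hR : R z ≤ G x := R_le z x (by rw [dist_comm]; linarith [hδ0 x])
    have h1 : 17 * δ x * R z ≤ 17 * δ x * G x := by have := hδ0 x; gcongr
    have h2 : 0 ≤ 272 * R z * dist x z := by have := R0 z; positivity
    simp only [hΦ]
    rw [abs_le] at this
    linarith
  have Φbig : ∀ x z, δ x < 1 / 8 → dist x z ≤ δ x / 4 → δ x / 16 ≤ dist x z → m x ≤ Φ x z := by
    intro x z hx hxz hz
    have := near x z hx hxz
    simp only [hΦ]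
    rw [abs_le] at this
    have h1 : 272 * R z * (δ x / 16) ≤ 272 * R z * dist x z := by have := R0 z; gcongr
    nlinarith
  have v_le : ∀ x z, δ x < 1 / 8 → dist x z ≤ δ x / 8 → v x ≤ Φ x z := by
    intro x z hx hz
    exact ciInf_le (f := fun z : Metric.closedBall x (δ x / 8) => Φ x z.1)
      ⟨m x - 17 * δ x * G x, by
        rintro _ ⟨w, rfl⟩
        exact Φlow x w hx (by rw [dist_comm]; exact w.2)⟩
      ⟨z, by rwa [Metric.mem_closedBall, dist_comm]⟩
  have le_v : ∀ x c, (∀ z, dist x z ≤ δ x / 8 → c ≤ Φ x z) → c ≤ v x := fun x c hc => by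
    have := ne x (δ x / 8) (by have := hδ0 x; positivity)
    exact le_ciInf fun w => hc w (by rw [dist_comm]; exact w.2)
  have vm : ∀ x, δ x < 1 / 8 → |v x - m x| ≤ 17 * δ x * G x := by
    intro x hx
    have h1 := v_le x x hx (by rw [dist_self]; have := hδ0 x; positivity)
    rw [Φself] at h1
    have h2 := le_v x _ fun z hz => Φlow x z hx hz
    have h3 : 0 ≤ 17 * δ x * G x := by have := hG x; have := hδ0 x; positivity
    rw [abs_le]
    constructor <;> linarith
  have approx : ∀ x r, δ x < r / 2 → r ≤ 1 →
      ∃ y ∈ S, dist x y < r ∧ h y ≤ G x ∧ |m x - u y| ≤ 2 * G x * r := by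
    intro x r hr hr1
    obtain ⟨y, hyS, hxy, hy⟩ := hsel x r hr hr1
    have hr0 : 0 < r := lt_of_le_of_lt dist_nonneg hxy
    have hPx : h y ≤ P x := le_P x _ fun w hw => hy w (by linarith [hδ0 x])
    have hPG : P x ≤ G x := P_le x x (by simp [hδ0 x])
    refine ⟨y, hyS, hxy, hPx.trans hPG, (hm x y hyS hPx).trans ?_⟩
    have := P0 x
    have := hG x
    gcongr
  have vabs : ∀ x, δ x < 1 / 20 → |v x| ≤ 20 * G x := by
    intro x hx
    obtain ⟨y, hyS, hxy, hy, hmy⟩ := approx x 1 (by linarith) le_rfl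
    have h1 := vm x (by linarith)
    have h2 := hu y hyS
    have h3 : 17 * δ x * G x ≤ 17 * (1 / 20) * G x := by have := hG x; gcongr
    have := hG x
    rw [abs_le] at *
    constructor <;> linarith
  have vclose : ∀ x x', δ x < 1 / 8 → δ x' < 1 / 8 → dist x x' ≤ δ x / 64 →
      v x ≤ v x' + 272 * dist x x' * G x' := by
    intro x x' hx hx' hd
    have e1 := hδd x x'
    have e2 := hδd x' x
    rw [dist_comm x' x] at e2
    have key : ∀ z, dist x' z ≤ δ x' / 16 → v x ≤ Φ x' z + 272 * dist x x' * G x' := by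
      intro z hz
      have e3 := hδd x' z
      have hR : R z ≤ G x' := R_le z x' (by rw [dist_comm]; linarith [hδ0 x'])
      have t := dist_triangle x x' z
      refine (v_le x z hx (by linarith [hδ0 x])).trans ?_
      simp only [hΦ]
      have h1 : R z * dist x z ≤ R z * (dist x x' + dist x' z) := by have := R0 z; gcongr
      have h2 : R z * dist x x' ≤ G x' * dist x x' := by gcongr
      nlinarith
    suffices v x - 272 * dist x x' * G x' ≤ v x' by linarith
    refine le_v x' _ fun z hz => ?_
    rcases le_total (dist x' z) (δ x' / 16) with h1 | h1
    · linarith [key z h1]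
    · have := key x' (by rw [dist_self]; have := hδ0 x'; positivity)
      rw [Φself] at this
      linarith [Φbig x' z hx' (by linarith [hδ0 x']) h1]
  have vfar : ∀ x x', δ x < 1 / 20 → δ x' < 1 / 20 → δ x / 64 < dist x x' →
      |v x - v x'| ≤ 40000 * dist x x' * (G x + G x') := by
    intro x x' hx hx' hd
    have e := hδd x' x
    rw [dist_comm x' x] at e
    have gx := hG x
    have gx' := hG x'
    set D := dist x x' with hD
    have D0 : 0 < D := lt_of_le_of_lt (by have := hδ0 x; positivity) hd
    have p1 := mul_nonneg D0.le gx
    have p2 := mul_nonneg D0.le gx'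
    rcases le_or_gt (131 * D) 1 with hD1 | hD1
    · obtain ⟨y, hyS, hxy, hy, hmy⟩ := approx x (131 * D) (by linarith) hD1
      obtain ⟨y', hyS', hxy', hy', hmy'⟩ := approx x' (131 * D) (by linarith) hD1
      have h1 := vm x (by linarith)
      have h2 := vm x' (by linarith)
      have h3 := hgrad y hyS y' hyS'
      have h4 : dist y y' ≤ 263 * D := by
        linarith [dist_triangle4 y x x' y', dist_comm y x]
      have h5 : dist y y' * (h y + h y') ≤ 263 * D * (G x + G x') := by
        refine (mul_le_mul_of_nonneg_left (add_le_add hy hy') dist_nonneg).trans ?_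
        gcongr
      have h6 : 17 * δ x * G x ≤ 17 * (65 * D) * G x := by gcongr; linarith
      have h7 : 17 * δ x' * G x' ≤ 17 * (65 * D) * G x' := by gcongr; linarith
      rw [abs_le] at *
      constructor <;> nlinarith
    · have h1 := vabs x hx
      have h2 := vabs x' hx'
      have h3 : G x ≤ 131 * D * G x := le_mul_of_one_le_left gx hD1.le
      have h4 : G x' ≤ 131 * D * G x' := le_mul_of_one_le_left gx' hD1.le
      rw [abs_le] at *
      constructor <;> nlinarith
  refine ⟨v, ?_, vabs, ?_⟩
  · intro x hx
    have hx0 : δ x = 0 := Metric.infDist_zero_of_mem hx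
    have h1 := vm x (by rw [hx0]; norm_num)
    have h2 : h x ≤ P x := le_P x _ fun w hw => by
      rw [hx0] at hw
      rw [← dist_le_zero.1 hw]
      exact hhG x hx
    have h3 := hm x x hx h2
    rw [dist_self, mul_zero] at h3
    rw [hx0, mul_zero, zero_mul] at h1
    linarith [abs_nonpos_iff.1 h1, abs_nonpos_iff.1 h3]
  · intro x x' hx hx'
    change δ x < 1 / 20 at hx
    change δ x' < 1 / 20 at hx'
    rcases le_or_gt (dist x x') (δ x / 64) with h1 | h1
    · rcases le_or_gt (dist x x') (δ x' / 64) with h2 | h2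
      · have a := vclose x x' (by linarith) (by linarith) h1
        have b := vclose x' x (by linarith) (by linarith) (by rw [dist_comm]; exact h2)
        rw [dist_comm x' x] at b
        have := mul_nonneg (dist_nonneg (x := x) (y := x')) (hG x)
        have := mul_nonneg (dist_nonneg (x := x) (y := x')) (hG x')
        rw [abs_le]
        constructor <;> nlinarith
      · have := vfar x' x hx' hx (by rwa [dist_comm])
        rwa [abs_sub_comm, dist_comm, add_comm (G x)]
    · exact vfar x x' hx hx' h1

/-- Global version of `exists_local_extension`, obtained by multiplying with a Lipschitz cutoff. -/
lemma exists_global_extension {Y : Type*} [MetricSpace Y] (S : Set Y) (u h G : Y → ℝ)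
    (hG : ∀ x, 0 ≤ G x) (hu : ∀ x ∈ S, |u x| ≤ h x)
    (hgrad : ∀ x ∈ S, ∀ y ∈ S, |u x - u y| ≤ dist x y * (h x + h y))
    (hhG : ∀ x ∈ S, h x ≤ G x)
    (hsel : ∀ x r, Metric.infDist x S < r / 2 → r ≤ 1 →
      ∃ y ∈ S, dist x y < r ∧ ∀ w, dist x w < r → h y ≤ G w) :
    ∃ v : Y → ℝ, (∀ x ∈ S, v x = u x) ∧ (∀ x, |v x| ≤ 20 * G x) ∧
      ∀ x x', |v x - v x'| ≤ dist x x' * (50000 * G x + 50000 * G x') := by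
  obtain ⟨v, hvu, hv1, hv2⟩ := exists_local_extension S u h G hG hu hgrad hhG hsel
  set ψ : Y → ℝ := fun x => max 0 (1 - 20 * Metric.infDist x S) with hψ
  have ψ0 : ∀ x, 0 ≤ ψ x := fun x => le_max_left _ _
  have ψ1 : ∀ x, ψ x ≤ 1 := fun x =>
    max_le zero_le_one (by linarith [Metric.infDist_nonneg (x := x) (s := S)])
  have ψout : ∀ x, 1 / 20 ≤ Metric.infDist x S → ψ x = 0 := fun x hx =>
    max_eq_left (by linarith)
  have ψL : ∀ x y, ψ x ≤ ψ y + 20 * dist x y := by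
    intro x y
    have e := Metric.infDist_le_infDist_add_dist (x := y) (y := x) (s := S)
    rw [dist_comm] at e
    refine max_le (by have := ψ0 y; positivity) ?_
    have : 1 - 20 * Metric.infDist y S ≤ ψ y := le_max_right _ _
    linarith
  have bound : ∀ x, |ψ x * v x| ≤ 20 * G x := by
    intro x
    rcases lt_or_ge (Metric.infDist x S) (1 / 20) with hx | hx
    · rw [abs_mul, abs_of_nonneg (ψ0 x)]
      exact (mul_le_of_le_one_left (abs_nonneg _) (ψ1 x)).trans (hv1 x hx)
    · rw [ψout x hx]
      have := hG x
      simpa using this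
  -- a point in the support against an arbitrary point
  have aux : ∀ x x', Metric.infDist x S < 1 / 20 → |ψ x * v x - ψ x' * v x'| ≤
      dist x x' * (50000 * G x + 50000 * G x') := by
    intro x x' hx
    have D0 : 0 ≤ dist x x' := dist_nonneg
    have p1 := mul_nonneg D0 (hG x)
    have p2 := mul_nonneg D0 (hG x')
    have hψd : |ψ x - ψ x'| ≤ 20 * dist x x' := by
      have h1 := ψL x x'
      have h2 := ψL x' x
      rw [dist_comm x' x] at h2
      rw [abs_le]
      constructor <;> linarith
    rcases lt_or_ge (Metric.infDist x' S) (1 / 20) with hx' | hx'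
    · have h1 := hv2 x x' hx hx'
      have h2 := hv1 x hx
      have h3 : ψ x * v x - ψ x' * v x' = (ψ x - ψ x') * v x + ψ x' * (v x - v x') := by ring
      rw [h3]
      refine (abs_add_le _ _).trans ?_
      rw [abs_mul, abs_mul, abs_of_nonneg (ψ0 x')]
      have h4 : |ψ x - ψ x'| * |v x| ≤ 20 * dist x x' * (20 * G x) := by gcongr
      have h5 : ψ x' * |v x - v x'| ≤ |v x - v x'| :=
        mul_le_of_le_one_left (abs_nonneg _) (ψ1 x')
      nlinarith
    · rw [ψout x' hx'] at hψd ⊢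
      rw [sub_zero] at hψd
      rw [zero_mul, sub_zero, abs_mul]
      have : |ψ x| * |v x| ≤ 20 * dist x x' * (20 * G x) := by
        have := hv1 x hx
        gcongr
      nlinarith
  refine ⟨fun x => ψ x * v x, fun x hx => ?_, bound, fun x x' => ?_⟩
  · have : ψ x = 1 := by simp [hψ, Metric.infDist_zero_of_mem hx]
    simp [this, hvu x hx]
  · rcases lt_or_ge (Metric.infDist x S) (1 / 20) with hx | hx
    · exact aux x x' hx
    · rcases lt_or_ge (Metric.infDist x' S) (1 / 20) with hx' | hx'
      · have := aux x' x hx'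
        rwa [abs_sub_comm, dist_comm, add_comm (50000 * G x)]
      · simp only [ψout x hx, ψout x' hx']
        have := hG x
        have := hG x'
        simp only [zero_mul, sub_self, abs_zero]
        positivity

section Maximal

variable {Y : Type*} [MetricSpace Y] [MeasurableSpace Y]

/-- The restricted (radii at most `1`) uncentered Hardy–Littlewood maximal function. -/
def maxFn (μ : Measure Y) (f : Y → ℝ≥0∞) (x : Y) : ℝ≥0∞ :=
  ⨆ (z : Y) (r : ℝ) (_ : 0 < r ∧ r ≤ 1 ∧ dist x z < r),
    (∫⁻ y in Metric.ball z r, f y ∂μ) / μ (Metric.ball z r)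

lemma le_maxFn (μ : Measure Y) (f : Y → ℝ≥0∞) {x z : Y} {r : ℝ} (hr : 0 < r) (hr1 : r ≤ 1)
    (hx : dist x z < r) :
    (∫⁻ y in Metric.ball z r, f y ∂μ) / μ (Metric.ball z r) ≤ maxFn μ f x :=
  le_iSup_of_le z <| le_iSup_of_le r <| le_iSup_of_le ⟨hr, hr1, hx⟩ le_rfl

lemma lt_maxFn_iff (μ : Measure Y) (f : Y → ℝ≥0∞) {x : Y} {c : ℝ≥0∞} :
    c < maxFn μ f x ↔ ∃ z : Y, ∃ r : ℝ, (0 < r ∧ r ≤ 1 ∧ dist x z < r) ∧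
      c < (∫⁻ y in Metric.ball z r, f y ∂μ) / μ (Metric.ball z r) := by
  simp only [maxFn, lt_iSup_iff, exists_prop]

lemma measurable_maxFn [OpensMeasurableSpace Y] (μ : Measure Y) (f : Y → ℝ≥0∞) :
    Measurable (maxFn μ f) := by
  refine measurable_of_Ioi fun c => IsOpen.measurableSet ?_
  rw [Metric.isOpen_iff]
  intro x hx
  obtain ⟨z, r, ⟨h0, h1, h2⟩, hc⟩ := (lt_maxFn_iff μ f).1 hx
  refine ⟨r - dist x z, by linarith, fun y hy => (lt_maxFn_iff μ f).2 ⟨z, r, ⟨h0, h1, ?_⟩, hc⟩⟩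
  rw [Metric.mem_ball] at hy
  linarith [dist_triangle y x z]

/-- Weak type `(1, 1)` estimate for the maximal function. -/
lemma mul_meas_maxFn_le [OpensMeasurableSpace Y] (μ : Measure Y) [SFinite μ]
    (hpos : ∀ x r, 0 < r → 0 < μ (Metric.ball x r))
    (hfin : ∀ x r, μ (Metric.ball x r) < ∞) {D : ℝ≥0∞}
    (hD : ∀ x r, 0 < r → μ (Metric.ball x (2 * r)) ≤ D * μ (Metric.ball x r))
    (f : Y → ℝ≥0∞) (c : ℝ≥0∞) :
    c * μ {x | c < maxFn μ f x} ≤ D ^ 3 * ∫⁻ x, f x ∂μ := by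
  set t : Set (Y × ℝ) := {a | 0 < a.2 ∧ a.2 ≤ 1 ∧
    c * μ (Metric.ball a.1 a.2) < ∫⁻ y in Metric.ball a.1 a.2, f y ∂μ} with ht
  obtain ⟨w, hwt, hdisj, hcov⟩ := Vitali.exists_disjoint_subfamily_covering_enlargement_closedBall
    t (fun a => a.1) (fun a => a.2) 1 (fun a ha => ha.2.1) 7 (by norm_num)
  have hdisj' : Pairwise (Function.onFun Disjoint fun a : w => Metric.ball a.1.1 a.1.2) := by
    intro a b hab
    exact (hdisj a.2 b.2 (fun h => hab (Subtype.ext h))).mono Metric.ball_subset_closedBall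
      Metric.ball_subset_closedBall
  have hcount : Countable w := by
    have := Measure.countable_meas_pos_of_disjoint_iUnion (μ := μ)
      (As := fun a : w => Metric.ball a.1.1 a.1.2)
      (fun a => Metric.isOpen_ball.measurableSet) hdisj'
    have huniv : {a : w | 0 < μ (Metric.ball a.1.1 a.1.2)} = univ :=
      eq_univ_of_forall fun a => hpos _ _ (hwt a.2).1
    rw [huniv] at this
    exact countable_univ_iff.1 this
  have hsub : {x | c < maxFn μ f x} ⊆ ⋃ a : w, Metric.ball a.1.1 (2 * (2 * (2 * a.1.2))) := by
    intro x hx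
    obtain ⟨z, r, ⟨h0, h1, h2⟩, hc⟩ := (lt_maxFn_iff μ f).1 hx
    rw [ENNReal.lt_div_iff_mul_lt (Or.inl (hpos z r h0).ne') (Or.inl (hfin z r).ne)] at hc
    obtain ⟨b, hb, hbsub⟩ := hcov (z, r) ⟨h0, h1, hc⟩
    refine mem_iUnion.2 ⟨⟨b, hb⟩, ?_⟩
    have hxb := hbsub (Metric.mem_closedBall.2 h2.le)
    rw [Metric.mem_closedBall] at hxb
    rw [Metric.mem_ball]
    have := (hwt hb).1
    linarith
  calc c * μ {x | c < maxFn μ f x}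
      ≤ c * ∑' a : w, μ (Metric.ball a.1.1 (2 * (2 * (2 * a.1.2)))) := by
        gcongr
        exact (measure_mono hsub).trans (measure_iUnion_le _)
    _ ≤ c * ∑' a : w, D ^ 3 * μ (Metric.ball a.1.1 a.1.2) := by
        gcongr with a
        have h0 := (hwt a.2).1
        calc _ ≤ D * μ (Metric.ball a.1.1 (2 * (2 * a.1.2))) := hD _ _ (by positivity)
          _ ≤ D * (D * μ (Metric.ball a.1.1 (2 * a.1.2))) := by
            gcongr; exact hD _ _ (by positivity)
          _ ≤ D * (D * (D * μ (Metric.ball a.1.1 a.1.2))) := by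
            gcongr; exact hD _ _ h0
          _ = _ := by ring
    _ = D ^ 3 * ∑' a : w, c * μ (Metric.ball a.1.1 a.1.2) := by
        rw [ENNReal.tsum_mul_left, ENNReal.tsum_mul_left]; ring
    _ ≤ D ^ 3 * ∑' a : w, ∫⁻ y in Metric.ball a.1.1 a.1.2, f y ∂μ := by
        gcongr with a
        exact (hwt a.2).2.2.le
    _ = D ^ 3 * ∫⁻ y in ⋃ a : w, Metric.ball a.1.1 a.1.2, f y ∂μ := by
        rw [lintegral_iUnion (fun a => Metric.isOpen_ball.measurableSet) hdisj']
    _ ≤ D ^ 3 * ∫⁻ x, f x ∂μ := by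
        gcongr
        exact Measure.restrict_le_self

lemma maxFn_le_add (μ : Measure Y) (f : Y → ℝ≥0∞) (c : ℝ≥0∞) (x : Y) :
    maxFn μ f x ≤ maxFn μ (fun y => {y | c < f y}.indicator f y) x + c := by
  refine iSup_le fun z => iSup_le fun r => iSup_le fun h => ?_
  have hle : ∫⁻ y in Metric.ball z r, f y ∂μ ≤
      (∫⁻ y in Metric.ball z r, {y | c < f y}.indicator f y ∂μ) + c * μ (Metric.ball z r) := by
    calc ∫⁻ y in Metric.ball z r, f y ∂μ
        ≤ ∫⁻ y in Metric.ball z r, ({y | c < f y}.indicator f y + c) ∂μ := by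
          refine lintegral_mono fun y => ?_
          by_cases hy : c < f y
          · simp [indicator, hy]
          · simp only [indicator, mem_ofPred_eq, hy, if_false, zero_add]
            exact not_lt.1 hy
      _ = _ := by rw [lintegral_add_right _ measurable_const, setLIntegral_const]
  calc _ ≤ ((∫⁻ y in Metric.ball z r, {y | c < f y}.indicator f y ∂μ)
        + c * μ (Metric.ball z r)) / μ (Metric.ball z r) := by gcongr
    _ ≤ _ := by
      rw [ENNReal.add_div]
      gcongr
      · exact le_maxFn μ _ h.1 h.2.1 h.2.2
      · exact ENNReal.div_le_of_le_mul le_rfl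

lemma sq_le_lintegral (a : ℝ≥0∞) :
    a ^ 2 ≤ 16 * ∫⁻ t in Ioi (0 : ℝ),
      if ENNReal.ofReal (2 * t) < a then ENNReal.ofReal t else 0 := by
  have key : ∀ b : ℝ, 0 < b → ENNReal.ofReal b ≤ a →
      ENNReal.ofReal b ^ 2 ≤ 16 * ∫⁻ t in Ioi (0 : ℝ),
        if ENNReal.ofReal (2 * t) < a then ENNReal.ofReal t else 0 := by
    intro b hb hba
    calc ENNReal.ofReal b ^ 2 = 16 * ∫⁻ t in Ioo (b / 4) (b / 2), ENNReal.ofReal (b / 4) := by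
          rw [setLIntegral_const, Real.volume_Ioo, ← ENNReal.ofReal_mul (by positivity),
            ← ENNReal.ofReal_pow hb.le, ← ENNReal.ofReal_ofNat 16, ← ENNReal.ofReal_mul (by norm_num)]
          congr 1
          ring
      _ ≤ 16 * ∫⁻ t in Ioo (b / 4) (b / 2),
            if ENNReal.ofReal (2 * t) < a then ENNReal.ofReal t else 0 := by
          gcongr 16 * ?_
          refine setLIntegral_mono' measurableSet_Ioo fun t ht => ?_
          rw [if_pos]
          · exact ENNReal.ofReal_le_ofReal ht.1.le
          · refine lt_of_lt_of_le ?_ hba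
            rw [ENNReal.ofReal_lt_ofReal_iff hb]
            linarith [ht.2]
      _ ≤ _ := by
          gcongr 16 * ?_
          exact lintegral_mono_set fun t ht => lt_trans (by positivity) ht.1
  rcases eq_or_ne a 0 with rfl | h0
  · simp
  rcases eq_or_ne a ∞ with rfl | htop
  · refine le_of_forall_lt fun c hc => ?_
    have hc' : c ≠ ∞ := (hc.trans_le le_top).ne
    refine lt_of_lt_of_le ?_ (key (c.toReal + 1) (by positivity) le_top)
    rw [ENNReal.ofReal_add (by positivity) zero_le_one, ENNReal.ofReal_toReal hc',
      ENNReal.ofReal_one]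
    calc c < c + 1 := ENNReal.lt_add_right hc' one_ne_zero
      _ = (c + 1) * 1 := (mul_one _).symm
      _ ≤ (c + 1) * (c + 1) := by gcongr; exact le_add_self
      _ = _ := (sq _).symm
  · have := key a.toReal (ENNReal.toReal_pos h0 htop) (by rw [ENNReal.ofReal_toReal htop])
    rwa [ENNReal.ofReal_toReal htop] at this

lemma lintegral_if_lt (a : ℝ≥0∞) :
    ∫⁻ t in Ioi (0 : ℝ), (if ENNReal.ofReal t < a then (1 : ℝ≥0∞) else 0) ≤ a := by
  rcases eq_or_ne a ∞ with rfl | htop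
  · exact le_top
  calc _ ≤ ∫⁻ t : ℝ, (Ioo 0 a.toReal).indicator 1 t := by
        rw [← lintegral_indicator measurableSet_Ioi]
        refine lintegral_mono fun t => ?_
        by_cases ht : 0 < t
        · by_cases hta : ENNReal.ofReal t < a
          · have : t < a.toReal := (ENNReal.ofReal_lt_iff_lt_toReal ht.le htop).1 hta
            simp [indicator, ht, hta, this]
          · simp [indicator, ht, hta]
        · simp [indicator, ht]
    _ = a := by
        rw [lintegral_indicator_one measurableSet_Ioo, Real.volume_Ioo, sub_zero,
          ENNReal.ofReal_toReal htop]

/-- The maximal function is bounded on `L²`. -/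
lemma lintegral_maxFn_sq_le [OpensMeasurableSpace Y] (μ : Measure Y) [SFinite μ]
    (hpos : ∀ x r, 0 < r → 0 < μ (Metric.ball x r))
    (hfin : ∀ x r, μ (Metric.ball x r) < ∞) {D : ℝ≥0∞}
    (hD : ∀ x r, 0 < r → μ (Metric.ball x (2 * r)) ≤ D * μ (Metric.ball x r))
    {f : Y → ℝ≥0∞} (hf : Measurable f) :
    ∫⁻ x, maxFn μ f x ^ 2 ∂μ ≤ 16 * D ^ 3 * ∫⁻ x, f x ^ 2 ∂μ := by
  have hM := measurable_maxFn μ f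
  have hofR : Measurable fun q : Y × ℝ => ENNReal.ofReal q.2 :=
    ENNReal.measurable_ofReal.comp measurable_snd
  have m1 : Measurable fun q : Y × ℝ =>
      if ENNReal.ofReal (2 * q.2) < maxFn μ f q.1 then ENNReal.ofReal q.2 else 0 := by
    refine Measurable.ite (measurableSet_lt ?_ (hM.comp measurable_fst)) hofR measurable_const
    exact ENNReal.measurable_ofReal.comp (measurable_snd.const_mul 2)
  have m2 : Measurable fun q : Y × ℝ =>
      f q.1 * if ENNReal.ofReal q.2 < f q.1 then (1 : ℝ≥0∞) else 0 :=
    (hf.comp measurable_fst).mul (Measurable.ite (measurableSet_lt hofR (hf.comp measurable_fst))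
      measurable_const measurable_const)
  calc ∫⁻ x, maxFn μ f x ^ 2 ∂μ
      ≤ ∫⁻ x, 16 * (∫⁻ t in Ioi (0 : ℝ), if ENNReal.ofReal (2 * t) < maxFn μ f x
          then ENNReal.ofReal t else 0) ∂μ := lintegral_mono fun x => sq_le_lintegral _
    _ = 16 * ∫⁻ t in Ioi (0 : ℝ), ∫⁻ x, (if ENNReal.ofReal (2 * t) < maxFn μ f x
          then ENNReal.ofReal t else 0) ∂μ := by
        rw [lintegral_const_mul' _ _ (by norm_num), lintegral_lintegral_swap m1.aemeasurable]
    _ ≤ 16 * ∫⁻ t in Ioi (0 : ℝ), D ^ 3 * ∫⁻ x, (f x *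
          if ENNReal.ofReal t < f x then (1 : ℝ≥0∞) else 0) ∂μ := by
        gcongr 16 * ?_
        refine lintegral_mono fun t => ?_
        have hset : MeasurableSet {x | ENNReal.ofReal (2 * t) < maxFn μ f x} :=
          measurableSet_lt measurable_const hM
        have e1 : (fun x => if ENNReal.ofReal (2 * t) < maxFn μ f x then ENNReal.ofReal t else 0) =
            {x | ENNReal.ofReal (2 * t) < maxFn μ f x}.indicator fun _ => ENNReal.ofReal t := by
          funext x
          simp [indicator]
        have e2 : (fun x => f x * if ENNReal.ofReal t < f x then (1 : ℝ≥0∞) else 0) =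
            fun x => {y | ENNReal.ofReal t < f y}.indicator f x := by
          funext x
          simp [indicator]
        rw [e1, lintegral_indicator_const hset, e2]
        refine le_trans ?_ (mul_meas_maxFn_le μ hpos hfin hD _ (ENNReal.ofReal t))
        refine mul_le_mul_right (measure_mono fun x hx => ?_) _
        have h1 : ENNReal.ofReal (2 * t) < maxFn μ f x := hx
        have h2 := h1.trans_le (maxFn_le_add μ f (ENNReal.ofReal t) x)
        by_contra h3
        rw [mem_ofPred_eq, not_lt] at h3
        refine absurd h2 (not_lt.2 ?_)
        rw [ENNReal.ofReal_mul zero_le_two, ENNReal.ofReal_ofNat, two_mul]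
        gcongr
    _ = 16 * (D ^ 3 * ∫⁻ x, f x * (∫⁻ t in Ioi (0 : ℝ),
          if ENNReal.ofReal t < f x then (1 : ℝ≥0∞) else 0) ∂μ) := by
        have m3 : Measurable fun t : ℝ => ∫⁻ x, f x *
            (if ENNReal.ofReal t < f x then (1 : ℝ≥0∞) else 0) ∂μ :=
          Measurable.lintegral_prod_right' (m2.comp measurable_swap)
        rw [lintegral_const_mul _ m3]
        congr 2
        rw [← lintegral_lintegral_swap (μ := μ) (ν := volume.restrict (Ioi (0 : ℝ)))
          (f := fun x t => f x * if ENNReal.ofReal t < f x then (1 : ℝ≥0∞) else 0) m2.aemeasurable]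
        refine lintegral_congr fun x => ?_
        rw [lintegral_const_mul]
        exact Measurable.ite (measurableSet_lt ENNReal.measurable_ofReal measurable_const)
          measurable_const measurable_const
    _ ≤ 16 * (D ^ 3 * ∫⁻ x, f x ^ 2 ∂μ) := by
        gcongr with x
        rw [pow_two]
        gcongr
        exact lintegral_if_lt _
    _ = _ := by ring

end Maximal

section Setup

/-- The metric space structure given by a distance function. -/
abbrev IsMetricDist.metricSpace {Y : Type*} {ρ : Y → Y → ℝ} (h : IsMetricDist ρ) :
    MetricSpace Y where
  dist := ρ
  dist_self x := (h.2.1 x x).2 rfl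
  dist_comm := h.2.2.1
  dist_triangle x y z := h.2.2.2 x z y
  eq_of_dist_eq_zero {x y} hxy := (h.2.1 x y).1 hxy

variable {Y : Type*} [MetricSpace Y]

lemma qball_dist (x : Y) (r : ℝ) : qball dist x r = Metric.ball x r := by
  ext y
  simp [qball, dist_comm]

variable [MeasurableSpace Y]

lemma sigmaFinite_of_ball_lt_top (μ : Measure Y)
    (hfin : ∀ (x : Y) r, μ (Metric.ball x r) < ∞) : SigmaFinite μ := by
  rcases isEmpty_or_nonempty Y with h | ⟨⟨x⟩⟩
  · rw [Measure.eq_zero_of_isEmpty μ]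
    infer_instance
  · exact ⟨⟨{ set := fun n : ℕ => Metric.ball x n
              set_mem := fun _ => trivial
              finite := fun n => hfin x n
              spanning := Metric.iUnion_ball_nat x }⟩⟩

lemma secondCountable_of_meas_ball_pos (μ : Measure Y) [SFinite μ]
    (hmeas : ∀ (x : Y) r, MeasurableSet (Metric.ball x r))
    (hpos : ∀ (x : Y) r, 0 < r → 0 < μ (Metric.ball x r)) : SecondCountableTopology Y := by
  refine Metric.secondCountable_of_almost_dense_set fun ε hε => ?_
  obtain ⟨w, -, hdisj, hcov⟩ := Vitali.exists_disjoint_subfamily_covering_enlargement_closedBall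
    (univ : Set Y) (fun a => a) (fun _ => ε / 5) (ε / 5) (fun _ _ => le_rfl) 5 (by norm_num)
  refine ⟨w, ?_, fun x => ?_⟩
  · have hdisj' : Pairwise (Function.onFun Disjoint fun a : w => Metric.ball a.1 (ε / 5)) := by
      intro a b hab
      exact (hdisj a.2 b.2 (fun h => hab (Subtype.ext h))).mono Metric.ball_subset_closedBall
        Metric.ball_subset_closedBall
    have hc := Measure.countable_meas_pos_of_disjoint_iUnion (μ := μ)
      (As := fun a : w => Metric.ball a.1 (ε / 5)) (fun a => hmeas _ _) hdisj'
    have huniv : {a : w | 0 < μ (Metric.ball a.1 (ε / 5))} = univ :=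
      eq_univ_of_forall fun a => hpos _ _ (by positivity)
    rw [huniv, countable_univ_iff] at hc
    exact hc
  · obtain ⟨b, hb, hsub⟩ := hcov x (mem_univ x)
    have := hsub (Metric.mem_closedBall_self (by positivity))
    rw [Metric.mem_closedBall] at this
    exact ⟨b, hb, by linarith⟩

lemma opensMeasurable_of_measurable_ball [SecondCountableTopology Y]
    (hmeas : ∀ (x : Y) r, MeasurableSet (Metric.ball x r)) : OpensMeasurableSpace Y := by
  refine ⟨MeasurableSpace.generateFrom_le fun U hU => ?_⟩
  have hU' : IsOpen U := hU
  choose! r hr0 hr using Metric.isOpen_iff.1 hU'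
  obtain ⟨T, hT, hTU⟩ := TopologicalSpace.isOpen_iUnion_countable
    (fun x : U => Metric.ball x.1 (r x.1)) (fun _ => Metric.isOpen_ball)
  have hUeq : U = ⋃ x ∈ T, Metric.ball x.1 (r x.1) := by
    rw [hTU]
    refine subset_antisymm (fun x hx => ?_) (iUnion_subset fun x => hr x.1 x.2)
    exact mem_iUnion.2 ⟨⟨x, hx⟩, Metric.mem_ball_self (hr0 x hx)⟩
  rw [hUeq]
  exact MeasurableSet.biUnion hT fun _ _ => hmeas _ _

/-- A `Q`-doubling measure on a metric space is doubling. -/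
lemma QDoubling.exists_doubling {μ : Measure Y} {Q : ℝ} (h : QDoubling dist μ Q) :
    ∃ D : ℝ, 1 ≤ D ∧ ∀ (x : Y) r, 0 < r →
      μ (Metric.ball x (2 * r)) ≤ ENNReal.ofReal D * μ (Metric.ball x r) := by
  obtain ⟨κ, hκ, h⟩ := h
  have hc : 0 < κ * (1 / 2 : ℝ) ^ Q := by positivity
  refine ⟨max 1 (κ * (1 / 2 : ℝ) ^ Q)⁻¹, le_max_left _ _, fun x r hr => ?_⟩
  have h1 := h x x r (2 * r) hr (by linarith)
    (by rw [qball_dist, qball_dist]; exact Metric.ball_subset_ball (by linarith))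
  rw [qball_dist, qball_dist, show r / (2 * r) = 1 / 2 by field_simp] at h1
  calc μ (Metric.ball x (2 * r))
      = ENNReal.ofReal (κ * (1 / 2 : ℝ) ^ Q)⁻¹ *
          (ENNReal.ofReal (κ * (1 / 2 : ℝ) ^ Q) * μ (Metric.ball x (2 * r))) := by
        rw [← mul_assoc, ← ENNReal.ofReal_mul (by positivity), inv_mul_cancel₀ hc.ne',
          ENNReal.ofReal_one, one_mul]
    _ ≤ _ := by
        gcongr
        exact le_max_right _ _

end Setup

section Extension

variable {Y : Type*} [MetricSpace Y] [MeasurableSpace Y]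

/-- In a domain with the measure density condition, near any point close to the domain there is a
point of the domain at which `f` is controlled by its maximal function. -/
lemma exists_le_maxFn [OpensMeasurableSpace Y] {μ : Measure Y}
    (hpos : ∀ x r, 0 < r → 0 < μ (Metric.ball x r))
    (hfin : ∀ x r, μ (Metric.ball x r) < ∞) {D c : ℝ≥0∞}
    (hD : ∀ x r, 0 < r → μ (Metric.ball x (2 * r)) ≤ D * μ (Metric.ball x r))
    {Ω : Set Y} (hΩ : MeasurableSet Ω)
    (hdens : ∀ x ∈ Ω, ∀ r, 0 < r → r ≤ 1 → μ (Metric.ball x r) ≤ c * μ (Metric.ball x r ∩ Ω))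
    {f : Y → ℝ≥0∞} (hf : Measurable f) {N : Set Y} (hN : μ N = 0) {x x₀ : Y} {r : ℝ}
    (hx₀ : x₀ ∈ Ω) (hxx₀ : dist x x₀ < r / 2) (hr1 : r ≤ 1) :
    ∃ y ∈ Ω \ N, dist x y < r ∧ ∀ w, dist x w < r → f y ≤ D ^ 2 * c * maxFn μ f w := by
  have hr : 0 < r := by linarith [dist_nonneg (x := x) (y := x₀)]
  set A := Metric.ball x r ∩ Ω with hA
  have hAm : MeasurableSet A := Metric.isOpen_ball.measurableSet.inter hΩ
  have hAfin : μ A < ∞ := (measure_mono inter_subset_left).trans_lt (hfin x r)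
  have hle : μ (Metric.ball x r) ≤ D ^ 2 * c * μ A := by
    calc μ (Metric.ball x r) ≤ μ (Metric.ball x₀ (2 * (2 * (r / 2)))) :=
          measure_mono (Metric.ball_subset_ball' (by linarith))
      _ ≤ D * (D * μ (Metric.ball x₀ (r / 2))) := by
          refine (hD _ _ (by positivity)).trans ?_
          gcongr
          exact hD _ _ (by positivity)
      _ ≤ D * (D * (c * μ (Metric.ball x₀ (r / 2) ∩ Ω))) := by
          gcongr
          exact hdens x₀ hx₀ _ (by positivity) (by linarith)
      _ ≤ D * (D * (c * μ A)) := by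
          gcongr
          exact inter_subset_inter_left _ (Metric.ball_subset_ball' (by linarith [dist_comm x x₀]))
      _ = _ := by ring
  have hA0 : μ A ≠ 0 := by
    intro h
    rw [h, mul_zero] at hle
    exact (hpos x r hr).not_ge hle
  have hrestr : μ.restrict A ≠ 0 := by rwa [Ne, Measure.restrict_eq_zero]
  have hnull : μ.restrict A (N ∪ Aᶜ) = 0 := by
    refine measure_union_null (Measure.absolutelyContinuous_of_le Measure.restrict_le_self hN) ?_
    rw [Measure.restrict_apply hAm.compl]
    simp
  obtain ⟨y, hyN, hy⟩ : ∃ y, y ∉ N ∪ Aᶜ ∧ f y ≤ ⨍⁻ a, f a ∂(μ.restrict A) := by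
    by_cases hint : ∫⁻ a, f a ∂(μ.restrict A) = ∞
    · obtain ⟨y, hy⟩ : (A \ N).Nonempty := by
        refine nonempty_of_measure_ne_zero (μ := μ) ?_
        rwa [measure_sdiff_null hN]
      refine ⟨y, by simp [hy.1, hy.2], ?_⟩
      rw [laverage_eq, hint, ENNReal.top_div_of_ne_top]
      · exact le_top
      · simpa using hAfin.ne
    · have : IsFiniteMeasure (μ.restrict A) := ⟨by simpa using hAfin⟩
      exact exists_notMem_null_le_laverage hrestr hf.aemeasurable hnull
  rw [mem_union, not_or, notMem_compl_iff] at hyN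
  refine ⟨y, ⟨hyN.2.2, hyN.1⟩, by rw [dist_comm]; exact hyN.2.1, fun w hw => hy.trans ?_⟩
  have hb0 := (hpos x r hr).ne'
  have hbt := (hfin x r).ne
  calc ⨍⁻ a, f a ∂(μ.restrict A) = (∫⁻ a in A, f a ∂μ) / μ A := by
        rw [laverage_eq, Measure.restrict_apply_univ]
    _ ≤ (∫⁻ a in A, f a ∂μ) * (D ^ 2 * c / μ (Metric.ball x r)) := by
        rw [div_eq_mul_inv]
        gcongr
        rw [ENNReal.inv_le_iff_le_mul (fun _ => hA0) (fun h => absurd h hAfin.ne)]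
        rw [mul_div_assoc', ENNReal.le_div_iff_mul_le (Or.inl hb0) (Or.inl hbt), one_mul, mul_comm]
        exact hle
    _ ≤ (∫⁻ a in Metric.ball x r, f a ∂μ) * (D ^ 2 * c / μ (Metric.ball x r)) := by
        gcongr
        exact inter_subset_left
    _ = D ^ 2 * c * ((∫⁻ a in Metric.ball x r, f a ∂μ) / μ (Metric.ball x r)) := by
        simp only [div_eq_mul_inv]; ring
    _ ≤ _ := by
        gcongr
        exact le_maxFn μ f hr hr1 (by rwa [dist_comm])

/-- A function with an almost everywhere measurable Hajłasz gradient is measurable. -/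
lemma aemeasurable_of_gradient [OpensMeasurableSpace Y] {μ : Measure Y} {v G : Y → ℝ}
    (hG : AEMeasurable G μ) {N : Set Y} (hN : μ N = 0)
    (hv : ∀ x ∉ N, ∀ y ∉ N, |v x - v y| ≤ dist x y * (G x + G y)) : AEMeasurable v μ := by
  have hS : (⋃ n : ℕ, {x | hG.mk G x ≤ n}) = univ := by
    refine eq_univ_of_forall fun x => mem_iUnion.2 ?_
    exact exists_nat_ge (hG.mk G x)
  rw [← Measure.restrict_univ (μ := μ), ← hS, aemeasurable_iUnion_iff]
  intro n
  have hm : MeasurableSet {x | hG.mk G x ≤ n} := measurableSet_le hG.measurable_mk measurable_const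
  set T : Set Y := {x | hG.mk G x ≤ n ∧ G x = hG.mk G x ∧ x ∉ N} with hT
  have hlip : LipschitzOnWith (2 * n) v T := by
    refine LipschitzOnWith.of_dist_le_mul fun x hx y hy => ?_
    rw [Real.dist_eq]
    refine (hv x hx.2.2 y hy.2.2).trans ?_
    rw [hx.2.1, hy.2.1, mul_comm]
    push_cast
    gcongr
    linarith [hx.1, hy.1]
  obtain ⟨w, hw, hwv⟩ := hlip.extend_real
  refine ⟨w, hw.continuous.measurable, ?_⟩
  rw [Filter.EventuallyEq, ae_restrict_iff' hm]
  filter_upwards [hG.ae_eq_mk, measure_eq_zero_iff_ae_notMem.1 hN] with x hx hxN hxn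
  exact hwv ⟨hxn, hx, hxN⟩

lemma ennreal_add_rpow_le (a b : ℝ≥0∞) {p : ℝ} (hp : 0 < p) :
    (a + b) ^ p ≤ 2 ^ p * (a ^ p + b ^ p) := by
  calc (a + b) ^ p ≤ (2 * max a b) ^ p := by
        gcongr
        rw [two_mul]
        exact add_le_add (le_max_left _ _) (le_max_right _ _)
    _ = 2 ^ p * max a b ^ p := ENNReal.mul_rpow_of_nonneg _ _ hp.le
    _ ≤ _ := by
        gcongr
        rcases le_total a b with h | h
        · rw [max_eq_right h]; exact le_add_self
        · rw [max_eq_left h]; exact le_self_add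

/-- Extension of a Hajłasz function from a domain with the measure density condition, with an
integral bound on a common majorant of the extension and its gradient. -/
lemma exists_extension_of_measDensity [OpensMeasurableSpace Y] {μ : Measure Y} [SFinite μ]
    (hpos : ∀ x r, 0 < r → 0 < μ (Metric.ball x r))
    (hfin : ∀ x r, μ (Metric.ball x r) < ∞) {D c : ℝ≥0∞} (hDtop : D ≠ ∞) (hctop : c ≠ ∞)
    (hD : ∀ x r, 0 < r → μ (Metric.ball x (2 * r)) ≤ D * μ (Metric.ball x r))
    {Ω : Set Y} (hΩ : MeasurableSet Ω)
    (hdens : ∀ x ∈ Ω, ∀ r, 0 < r → r ≤ 1 → μ (Metric.ball x r) ≤ c * μ (Metric.ball x r ∩ Ω))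
    {p : ℝ} (hp : 0 < p) {u h : Y → ℝ}
    (hhm : AEMeasurable h (μ.restrict Ω)) (huh : ∀ x ∈ Ω, |u x| ≤ h x) {E : Set Y} (hE : μ E = 0)
    (hgrad : ∀ x ∈ Ω \ E, ∀ y ∈ Ω \ E, |u x - u y| ≤ dist x y * (h x + h y))
    (hint : ∫⁻ x in Ω, ENNReal.ofReal (h x) ^ p ∂μ ≠ ∞) :
    ∃ v G : Y → ℝ, AEMeasurable G μ ∧ (∀ x, 0 ≤ G x) ∧ (∀ᵐ x ∂μ.restrict Ω, v x = u x) ∧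
      (∀ᵐ x ∂μ, |v x| ≤ G x) ∧
      (∃ N, μ N = 0 ∧ ∀ x ∉ N, ∀ y ∉ N, |v x - v y| ≤ dist x y * (G x + G y)) ∧
      ∫⁻ x, ENNReal.ofReal (G x) ^ p ∂μ ≤ ENNReal.ofReal 50000 ^ p * (2 ^ p *
        (1 + (D ^ 2 * c) ^ 2 * (16 * D ^ 3))) * ∫⁻ x in Ω, ENNReal.ofReal (h x) ^ p ∂μ := by
  set q := p / 2 with hq
  have hq0 : 0 < q := by positivity
  set a := D ^ 2 * c with ha
  have hatop : a ≠ ∞ := ENNReal.mul_ne_top (ENNReal.pow_ne_top hDtop) hctop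
  set H : Y → ℝ≥0∞ := Ω.indicator hhm.ennreal_ofReal.mk with hH
  have hHm : Measurable H := hhm.ennreal_ofReal.measurable_mk.indicator hΩ
  have hHae : ∀ᵐ x ∂μ, x ∈ Ω → ENNReal.ofReal (h x) = H x := by
    have := hhm.ennreal_ofReal.ae_eq_mk
    rw [Filter.EventuallyEq, ae_restrict_iff' hΩ] at this
    filter_upwards [this] with x hx hxΩ
    rw [hx hxΩ, hH, indicator_of_mem hxΩ]
  have hHint : ∫⁻ x, H x ^ p ∂μ = ∫⁻ x in Ω, ENNReal.ofReal (h x) ^ p ∂μ := by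
    rw [← lintegral_indicator hΩ]
    refine lintegral_congr_ae ?_
    filter_upwards [hHae] with x hx
    by_cases hxΩ : x ∈ Ω
    · rw [indicator_of_mem hxΩ, hx hxΩ]
    · rw [indicator_of_notMem hxΩ, hH, indicator_of_notMem hxΩ, ENNReal.zero_rpow_of_pos hp]
  set f : Y → ℝ≥0∞ := fun x => H x ^ q with hf
  have hfm : Measurable f := hHm.pow_const _
  have hMm := measurable_maxFn μ f
  set Γ : Y → ℝ≥0∞ := fun x => H x + (a * maxFn μ f x) ^ q⁻¹ with hΓ
  have hΓm : Measurable Γ := hHm.add ((hMm.const_mul a).pow_const _)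
  have hΓint : ∫⁻ x, Γ x ^ p ∂μ ≤ (2 ^ p * (1 + a ^ 2 * (16 * D ^ 3))) *
      ∫⁻ x in Ω, ENNReal.ofReal (h x) ^ p ∂μ := by
    calc ∫⁻ x, Γ x ^ p ∂μ ≤ ∫⁻ x, 2 ^ p * (H x ^ p + a ^ 2 * maxFn μ f x ^ 2) ∂μ := by
          refine lintegral_mono fun x => (ennreal_add_rpow_le _ _ hp).trans (le_of_eq ?_)
          rw [← ENNReal.rpow_mul, show q⁻¹ * p = (2 : ℕ) by rw [hq]; push_cast; field_simp,
            ENNReal.rpow_natCast, mul_pow]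
      _ = 2 ^ p * (∫⁻ x, H x ^ p ∂μ + a ^ 2 * ∫⁻ x, maxFn μ f x ^ 2 ∂μ) := by
          rw [lintegral_const_mul' _ _ (by simp),
            lintegral_add_left (hHm.pow_const _), lintegral_const_mul _ (hMm.pow_const _)]
      _ ≤ 2 ^ p * (∫⁻ x, H x ^ p ∂μ + a ^ 2 * (16 * D ^ 3 * ∫⁻ x, f x ^ 2 ∂μ)) := by
          gcongr
          exact lintegral_maxFn_sq_le μ hpos hfin hD hfm
      _ = _ := by
          have : ∀ x, f x ^ 2 = H x ^ p := fun x => by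
            rw [hf, ← ENNReal.rpow_natCast, ← ENNReal.rpow_mul, hq]
            congr 1
            push_cast
            ring
          simp_rw [this]
          rw [hHint]
          ring
  have hΓtop : ∀ᵐ x ∂μ, Γ x < ∞ := by
    have hne : ∫⁻ x, Γ x ^ p ∂μ ≠ ∞ := by
      refine ne_top_of_le_ne_top (ENNReal.mul_ne_top ?_ hint) hΓint
      refine ENNReal.mul_ne_top (by simp) ?_
      refine ENNReal.add_ne_top.2 ⟨one_ne_top, ENNReal.mul_ne_top (ENNReal.pow_ne_top hatop) ?_⟩
      exact ENNReal.mul_ne_top (by norm_num) (ENNReal.pow_ne_top hDtop)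
    filter_upwards [ae_lt_top (hΓm.pow_const p) hne] with x hx
    exact (ENNReal.rpow_lt_top_iff_of_pos hp).1 hx
  obtain ⟨N, hN, hNmem⟩ : ∃ N : Set Y, μ N = 0 ∧ ∀ x ∉ N,
      x ∉ E ∧ (x ∈ Ω → ENNReal.ofReal (h x) = H x) ∧ Γ x < ∞ :=
    ⟨_, ((measure_eq_zero_iff_ae_notMem.1 hE).and (hHae.and hΓtop)), fun x hx => not_not.1 hx⟩
  rcases (Ω \ N).eq_empty_or_nonempty with hemp | hne
  · have hΩ0 : μ Ω = 0 := measure_mono_null (sdiff_eq_empty.1 hemp) hN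
    refine ⟨0, 0, measurable_const.aemeasurable, fun _ => le_rfl, ?_, ?_, ⟨∅, by simp, ?_⟩, ?_⟩
    · rw [Measure.restrict_eq_zero.2 hΩ0]
      simp
    · simp
    · simp
    · simp [ENNReal.zero_rpow_of_pos hp]
  set S : Set {x // x ∉ N} := {x | x.1 ∈ Ω} with hS
  have hSne : S.Nonempty := ⟨⟨hne.some, hne.some_mem.2⟩, hne.some_mem.1⟩
  obtain ⟨v, hvu, hvG, hvgrad⟩ := exists_global_extension S (fun x => u x) (fun x => h x)
    (fun x => (Γ x).toReal) (fun x => ENNReal.toReal_nonneg) (fun x hx => huh x hx)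
    (fun x hx y hy => hgrad x ⟨hx, (hNmem x x.2).1⟩ y ⟨hy, (hNmem y y.2).1⟩)
    (fun x hx => by
      rw [← ENNReal.ofReal_le_iff_le_toReal (hNmem x x.2).2.2.ne, (hNmem x x.2).2.1 hx]
      exact le_self_add)
    (fun x r hxr hr => by
      obtain ⟨x₀, hx₀, hxx₀⟩ := (Metric.infDist_lt_iff hSne).1 hxr
      obtain ⟨y, hy, hxy, hyw⟩ := exists_le_maxFn hpos hfin hD hΩ hdens hfm hN hx₀ hxx₀ hr
      refine ⟨⟨y, hy.2⟩, hy.1, hxy, fun w hw => ?_⟩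
      rw [← ENNReal.ofReal_le_iff_le_toReal (hNmem w w.2).2.2.ne, (hNmem y hy.2).2.1 hy.1]
      refine le_trans ?_ le_add_self
      rw [ENNReal.le_rpow_inv_iff hq0]
      exact hyw w hw)
  classical
  set v' : Y → ℝ := fun x => if hx : x ∉ N then v ⟨x, hx⟩ else 0 with hv'
  have hvv : ∀ x (hx : x ∉ N), v' x = v ⟨x, hx⟩ := fun x hx => dif_pos hx
  refine ⟨v', fun x => 50000 * (Γ x).toReal, (hΓm.ennreal_toReal.const_mul _).aemeasurable,
    fun x => by positivity, ?_, ?_, ⟨N, hN, fun x hx y hy => ?_⟩, ?_⟩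
  · rw [ae_restrict_iff' hΩ]
    filter_upwards [measure_eq_zero_iff_ae_notMem.1 hN] with x hx hxΩ
    rw [hvv x hx]
    exact hvu ⟨x, hx⟩ hxΩ
  · filter_upwards [measure_eq_zero_iff_ae_notMem.1 hN] with x hx
    rw [hvv x hx]
    refine (hvG ⟨x, hx⟩).trans ?_
    gcongr
    norm_num
  · rw [hvv x hx, hvv y hy]
    exact hvgrad ⟨x, hx⟩ ⟨y, hy⟩
  · rw [mul_assoc]
    refine le_trans ?_ (mul_le_mul_right hΓint _)
    rw [← lintegral_const_mul _ (hΓm.pow_const _)]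
    refine lintegral_mono fun x => ?_
    dsimp only
    rw [ENNReal.ofReal_mul (by norm_num), ENNReal.mul_rpow_of_nonneg _ _ hp.le]
    gcongr
    exact ENNReal.ofReal_toReal_le

lemma M1pNorm_le_of_gradient {μ : Measure Y} {S : Set Y} {p : ℝ} (hp : 0 < p) {v G : Y → ℝ}
    (hG : IsSGradOn dist μ S 1 v G) (hv : ∀ᵐ x ∂μ.restrict S, |v x| ≤ G x) :
    lpOn μ S p v ≤ lpN (μ.restrict S) p (fun x => ENNReal.ofReal (G x)) ∧
    M1pDotNorm dist μ S p v ≤ lpN (μ.restrict S) p (fun x => ENNReal.ofReal (G x)) := by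
  refine ⟨?_, iInf₂_le G hG⟩
  unfold lpOn lpN
  refine ENNReal.rpow_le_rpow (lintegral_mono_ae ?_) (by positivity)
  filter_upwards [hv] with x hx
  gcongr

/-- The measure density condition implies the extension property. -/
lemma M1pExtDomain_of_density [OpensMeasurableSpace Y] {μ : Measure Y} [SFinite μ]
    (hpos : ∀ x r, 0 < r → 0 < μ (Metric.ball x r))
    (hfin : ∀ x r, μ (Metric.ball x r) < ∞) {D c : ℝ≥0∞} (hDtop : D ≠ ∞) (hctop : c ≠ ∞)
    (hD : ∀ x r, 0 < r → μ (Metric.ball x (2 * r)) ≤ D * μ (Metric.ball x r))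
    {Ω : Set Y} (hΩ : MeasurableSet Ω)
    (hdens : ∀ x ∈ Ω, ∀ r, 0 < r → r ≤ 1 → μ (Metric.ball x r) ≤ c * μ (Metric.ball x r ∩ Ω))
    {p : ℝ} (hp : 0 < p) : M1pExtDomain dist μ Ω p := by
  set K : ℝ≥0∞ := ENNReal.ofReal 50000 ^ p * (2 ^ p * (1 + (D ^ 2 * c) ^ 2 * (16 * D ^ 3))) with hK
  have hKtop : K ≠ ∞ := by
    refine ENNReal.mul_ne_top (by simp) (ENNReal.mul_ne_top (by simp) ?_)
    refine ENNReal.add_ne_top.2 ⟨one_ne_top, ENNReal.mul_ne_top (ENNReal.pow_ne_top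
      (ENNReal.mul_ne_top (ENNReal.pow_ne_top hDtop) hctop))
      (ENNReal.mul_ne_top (by norm_num) (ENNReal.pow_ne_top hDtop))⟩
  set L : ℝ≥0∞ := (K * (2 ^ p * (2 ^ p + 1))) ^ (1 / p) with hL
  have hLtop : L ≠ ∞ := by
    refine ENNReal.rpow_ne_top_of_nonneg (by positivity) (ENNReal.mul_ne_top hKtop ?_)
    exact ENNReal.mul_ne_top (by simp) (by simp)
  refine ⟨2 * L.toReal + 1, by positivity, fun u hu => ?_⟩
  obtain ⟨hum, hulp, hudot⟩ := hu
  set n := M1pNorm dist μ Ω p u with hn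
  have hntop : n ≠ ∞ := ENNReal.add_ne_top.2 ⟨hulp, hudot⟩
  rcases eq_or_ne n 0 with hn0 | hn0
  · have hzero : IsSGradOn dist μ univ 1 (0 : Y → ℝ) (0 : Y → ℝ) :=
      ⟨fun _ => le_rfl, measurable_const.aemeasurable, ∅, by simp, by simp⟩
    have hz : lpN (μ.restrict univ) p (fun x => ENNReal.ofReal ((0 : Y → ℝ) x)) = 0 := by
      simp [lpN, ENNReal.zero_rpow_of_pos hp, hp]
    obtain ⟨h1, h2⟩ := M1pNorm_le_of_gradient hp hzero (by simp)
    rw [hz, nonpos_iff_eq_zero] at h1 h2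
    refine ⟨0, ⟨measurable_const.aemeasurable, by simp [h1], by simp [h2]⟩, ?_, ?_⟩
    · have hu0 : lpOn μ Ω p u = 0 := (add_eq_zero.1 hn0).1
      unfold lpOn lpN at hu0
      rw [ENNReal.rpow_eq_zero_iff_of_pos (by positivity), lintegral_eq_zero_iff'] at hu0
      · filter_upwards [hu0] with x hx
        simpa [hp, hp.le, eq_comm, hp.not_gt] using hx
      · exact ((measurable_norm.comp_aemeasurable hum).ennreal_ofReal).pow_const p
    · simp [M1pNorm, h1, h2]
  obtain ⟨g, hg, hgn⟩ : ∃ g, IsSGradOn dist μ Ω 1 u g ∧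
      lpN (μ.restrict Ω) p (fun x => ENNReal.ofReal (g x)) < 2 * n := by
    have hlt : M1pDotNorm dist μ Ω p u < 2 * n := by
      refine lt_of_le_of_lt (le_add_self : _ ≤ n) ?_
      rw [two_mul]
      exact ENNReal.lt_add_right hntop hn0
    unfold M1pDotNorm at hlt
    simp only [iInf_lt_iff] at hlt
    obtain ⟨g, hg, h⟩ := hlt
    exact ⟨g, hg, h⟩
  obtain ⟨hg0, hgm, E, hE, hgE⟩ := hg
  have hhm : AEMeasurable (fun x => g x + |u x|) (μ.restrict Ω) :=
    hgm.add (measurable_norm.comp_aemeasurable hum)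
  have hrootp : ∀ (f : Y → ℝ≥0∞) (b : ℝ≥0∞), lpN (μ.restrict Ω) p f ≤ b →
      ∫⁻ x in Ω, f x ^ p ∂μ ≤ b ^ p := by
    intro f b hb
    unfold lpN at hb
    rwa [one_div, ENNReal.rpow_inv_le_iff hp] at hb
  have hint : ∫⁻ x in Ω, ENNReal.ofReal (g x + |u x|) ^ p ∂μ ≤ 2 ^ p * (2 ^ p + 1) * n ^ p := by
    calc ∫⁻ x in Ω, ENNReal.ofReal (g x + |u x|) ^ p ∂μ
        ≤ ∫⁻ x in Ω, 2 ^ p * (ENNReal.ofReal (g x) ^ p + ENNReal.ofReal |u x| ^ p) ∂μ := by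
          refine lintegral_mono fun x => ?_
          rw [ENNReal.ofReal_add (hg0 x) (abs_nonneg _)]
          exact ennreal_add_rpow_le _ _ hp
      _ = 2 ^ p * (∫⁻ x in Ω, ENNReal.ofReal (g x) ^ p ∂μ
            + ∫⁻ x in Ω, ENNReal.ofReal |u x| ^ p ∂μ) := by
          rw [lintegral_const_mul' _ _ (by simp), lintegral_add_left' (hgm.ennreal_ofReal.pow_const _)]
      _ ≤ 2 ^ p * ((2 * n) ^ p + n ^ p) := by
          gcongr
          · exact hrootp _ _ hgn.le
          · exact hrootp _ _ (le_self_add : lpOn μ Ω p u ≤ n)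
      _ = _ := by
          rw [ENNReal.mul_rpow_of_nonneg _ _ hp.le]
          ring
  have hinttop : ∫⁻ x in Ω, ENNReal.ofReal (g x + |u x|) ^ p ∂μ ≠ ∞ := by
    refine ne_top_of_le_ne_top (ENNReal.mul_ne_top (ENNReal.mul_ne_top (by simp) (by simp)) ?_) hint
    exact ENNReal.rpow_ne_top_of_nonneg hp.le hntop
  obtain ⟨v, G, hGm, hG0, hvu, hvG, ⟨N, hN, hgradv⟩, hGint⟩ :=
    exists_extension_of_measDensity hpos hfin hDtop hctop hD hΩ hdens hp
      hhm (u := u) (h := fun x => g x + |u x|) (fun x _ => le_add_of_nonneg_left (hg0 x)) hE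
      (fun x hx y hy => by
        refine (hgE x hx y hy).trans ?_
        rw [Real.rpow_one]
        gcongr <;> exact le_add_of_nonneg_right (abs_nonneg _)) hinttop
  have hvgrad : IsSGradOn dist μ univ 1 v G := by
    refine ⟨hG0, by rwa [Measure.restrict_univ], N, hN, fun x hx y hy => ?_⟩
    rw [Real.rpow_one]
    exact hgradv x hx.2 y hy.2
  have hGn : lpN (μ.restrict univ) p (fun x => ENNReal.ofReal (G x)) ≤ L * n := by
    unfold lpN
    rw [Measure.restrict_univ]
    calc (∫⁻ x, ENNReal.ofReal (G x) ^ p ∂μ) ^ (1 / p)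
        ≤ (K * (2 ^ p * (2 ^ p + 1) * n ^ p)) ^ (1 / p) := by
          gcongr
          exact hGint.trans (by gcongr)
      _ = L * n := by
          rw [hL, ← mul_assoc, ENNReal.mul_rpow_of_nonneg _ _ (by positivity), one_div,
            ENNReal.rpow_rpow_inv hp.ne']
  have hLn : L * n ≠ ∞ := ENNReal.mul_ne_top hLtop hntop
  obtain ⟨h1, h2⟩ := M1pNorm_le_of_gradient hp hvgrad (by rwa [Measure.restrict_univ])
  refine ⟨v, ⟨?_, ne_top_of_le_ne_top hLn (h1.trans hGn), ne_top_of_le_ne_top hLn (h2.trans hGn)⟩,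
    hvu, ?_⟩
  · rw [Measure.restrict_univ]
    exact aemeasurable_of_gradient hGm hN hgradv
  · calc M1pNorm dist μ univ p v ≤ L * n + L * n := add_le_add (h1.trans hGn) (h2.trans hGn)
      _ = 2 * L * n := by ring
      _ ≤ _ := by
        gcongr
        rw [ENNReal.ofReal_add (by positivity) zero_le_one, ENNReal.ofReal_mul zero_le_two,
          ENNReal.ofReal_toReal hLtop, ENNReal.ofReal_ofNat]
        exact le_self_add

end Extension

section Necessity

lemma exists_mem_notMem_of_lt {Y : Type*} [MeasurableSpace Y] {μ : Measure Y}
    {S T E : Set Y} (hE : μ E = 0) (h : μ T < μ S) :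
    ∃ x ∈ S, x ∉ T ∧ x ∉ E := by
  by_contra! hcon
  refine h.not_ge ?_
  calc μ S ≤ μ (T ∪ E) := measure_mono fun x hx => by
        by_cases hT : x ∈ T
        · exact Or.inl hT
        · exact Or.inr (hcon x hx hT)
    _ ≤ μ T + μ E := measure_union_le _ _
    _ = μ T := by rw [hE, add_zero]

variable {Y : Type*} [MetricSpace Y] [MeasurableSpace Y]

/-- A chain of points in balls of doubling radii along which the gradient decays geometrically. -/
lemma exists_chain_point {μ : Measure Y} (hfin : ∀ (x : Y) r, μ (Metric.ball x r) < ∞)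
    {κ Q : ℝ} (hκ : 0 < κ)
    (hQ : ∀ (x y : Y) (r R : ℝ), 0 < r → r ≤ R → Metric.ball x r ⊆ Metric.ball y R →
      ENNReal.ofReal (κ * (r / R) ^ Q) * μ (Metric.ball y R) ≤ μ (Metric.ball x r))
    {p : ℝ} (hpQ : 2 * p ≤ Q) {v g : Y → ℝ} {E : Set Y} (hE : μ E = 0)
    (hgrad : ∀ x ∉ E, ∀ y ∉ E, |v x - v y| ≤ dist x y * (g x + g y))
    {z : Y} {R ρ₀ G₀ m : ℝ} (hR : 0 < R) (hρ₀ : 0 < ρ₀) (hG₀ : 0 < G₀) (hm : 0 < m)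
    (hmV : m ≤ κ * (ρ₀ / (4 * R)) ^ Q * μ.real (Metric.ball z R))
    (hdistr : ∀ k : ℕ, μ {x | G₀ / 4 ^ k < g x} ≤ ENNReal.ofReal (m / 2 * (4 ^ p) ^ k))
    {A : Set Y} (hA : A ⊆ Metric.ball z R) (hmA : ENNReal.ofReal m ≤ μ A) (k : ℕ)
    (hk : ρ₀ * 2 ^ k ≤ R) :
    ∃ x ∈ A \ E, ∃ y ∉ E, dist y z < R + 2 * (ρ₀ * 2 ^ k) ∧ g y ≤ G₀ / 4 ^ k ∧
      |v y - v x| ≤ 10 * ρ₀ * G₀ * (1 - 1 / 2 ^ k) := by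
  induction k with
  | zero =>
    obtain ⟨x, hxA, hxg, hxE⟩ : ∃ x ∈ A, x ∉ {x | G₀ / 4 ^ 0 < g x} ∧ x ∉ E := by
      refine exists_mem_notMem_of_lt hE ((hdistr 0).trans_lt (lt_of_lt_of_le ?_ hmA))
      rw [ENNReal.ofReal_lt_ofReal_iff hm]
      simp [hm]
    refine ⟨x, ⟨hxA, hxE⟩, x, hxE, ?_, not_lt.1 hxg, by simp⟩
    have := hA hxA
    rw [Metric.mem_ball] at this
    linarith [mul_pos hρ₀ (pow_pos (two_pos (α := ℝ)) 0)]
  | succ k ih =>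
    have h2k : (0 : ℝ) < 2 ^ k := by positivity
    have hρk : 0 < ρ₀ * 2 ^ k := by positivity
    have hsucc : ρ₀ * 2 ^ (k + 1) = 2 * (ρ₀ * 2 ^ k) := by ring
    obtain ⟨x, hx, y, hyE, hyz, hgy, hvy⟩ := ih (by linarith)
    have hball : Metric.ball y (ρ₀ * 2 ^ (k + 1)) ⊆ Metric.ball z (4 * R) :=
      Metric.ball_subset_ball' (by linarith)
    obtain ⟨w, hwy, hwg, hwE⟩ : ∃ w ∈ Metric.ball y (ρ₀ * 2 ^ (k + 1)),
        w ∉ {x | G₀ / 4 ^ (k + 1) < g x} ∧ w ∉ E := by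
      refine exists_mem_notMem_of_lt hE ((hdistr (k + 1)).trans_lt (lt_of_lt_of_le ?_
        (hQ y z _ (4 * R) (by positivity) (by linarith) hball)))
      have h4p : ((4 : ℝ) ^ p) ^ (k + 1) ≤ ((2 : ℝ) ^ (k + 1)) ^ Q := by
        rw [← Real.rpow_natCast, ← Real.rpow_mul (by norm_num), ← Real.rpow_natCast,
          ← Real.rpow_mul (by norm_num), show (4 : ℝ) = 2 ^ (2 : ℝ) by norm_num,
          ← Real.rpow_mul (by norm_num)]
        refine Real.rpow_le_rpow_of_exponent_le (by norm_num) ?_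
        nlinarith [(Nat.cast_nonneg (k + 1) : (0 : ℝ) ≤ ((k + 1 : ℕ) : ℝ))]
      have hpos4 : (0 : ℝ) < ((4 : ℝ) ^ p) ^ (k + 1) := by positivity
      calc ENNReal.ofReal (m / 2 * (4 ^ p) ^ (k + 1))
          < ENNReal.ofReal (m * (4 ^ p) ^ (k + 1)) := by
            rw [ENNReal.ofReal_lt_ofReal_iff (by positivity)]
            gcongr
            linarith
        _ ≤ ENNReal.ofReal (κ * (ρ₀ * 2 ^ (k + 1) / (4 * R)) ^ Q * μ.real (Metric.ball z R)) := by
            apply ENNReal.ofReal_le_ofReal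
            calc m * (4 ^ p) ^ (k + 1) ≤ κ * (ρ₀ / (4 * R)) ^ Q * μ.real (Metric.ball z R)
                  * (2 ^ (k + 1)) ^ Q := by gcongr
              _ = _ := by
                rw [show ρ₀ * 2 ^ (k + 1) / (4 * R) = ρ₀ / (4 * R) * 2 ^ (k + 1) by ring,
                  Real.mul_rpow (by positivity) (by positivity)]
                ring
        _ = ENNReal.ofReal (κ * (ρ₀ * 2 ^ (k + 1) / (4 * R)) ^ Q) * μ (Metric.ball z R) := by
            rw [ENNReal.ofReal_mul (by positivity), ofReal_measureReal (hfin _ _).ne]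
        _ ≤ _ := by
            gcongr
            linarith
    refine ⟨x, hx, w, hwE, ?_, not_lt.1 hwg, ?_⟩
    · rw [Metric.mem_ball] at hwy
      linarith [dist_triangle w y z]
    · have h1 := hgrad w hwE y hyE
      rw [Metric.mem_ball] at hwy
      have hwg' : g w ≤ G₀ / 4 ^ (k + 1) := not_lt.1 hwg
      have h4 : (4 : ℝ) ^ k = 2 ^ k * 2 ^ k := by rw [← mul_pow]; norm_num
      have h2 : dist w y * (g w + g y) ≤ ρ₀ * 2 ^ (k + 1) * (G₀ / 4 ^ (k + 1) + G₀ / 4 ^ k) := by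
        calc dist w y * (g w + g y) ≤ dist w y * (G₀ / 4 ^ (k + 1) + G₀ / 4 ^ k) := by gcongr
          _ ≤ _ := by gcongr
      have h3 : ρ₀ * 2 ^ (k + 1) * (G₀ / 4 ^ (k + 1) + G₀ / 4 ^ k) = 5 / 2 * ρ₀ * G₀ * (1 / 2 ^ k) := by
        rw [pow_succ, pow_succ, h4]
        field_simp
        ring
      have h5 : (1 : ℝ) / 2 ^ (k + 1) = 1 / 2 ^ k / 2 := by rw [pow_succ]; field_simp
      have h6 : 0 < ρ₀ * G₀ * (1 / 2 ^ k) := by positivity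
      rw [h5]
      have := abs_sub_le (v w) (v y) (v x)
      linarith

/-- A function that is `1` and `0` on two sets of substantial measure has large oscillation
compared to its gradient. -/
lemma one_le_of_gradient_distribution {μ : Measure Y}
    (hfin : ∀ (x : Y) r, μ (Metric.ball x r) < ∞)
    {κ Q : ℝ} (hκ : 0 < κ)
    (hQ : ∀ (x y : Y) (r R : ℝ), 0 < r → r ≤ R → Metric.ball x r ⊆ Metric.ball y R →
      ENNReal.ofReal (κ * (r / R) ^ Q) * μ (Metric.ball y R) ≤ μ (Metric.ball x r))
    {p : ℝ} (hpQ : 2 * p ≤ Q) {v g : Y → ℝ} {E : Set Y} (hE : μ E = 0)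
    (hgrad : ∀ x ∉ E, ∀ y ∉ E, |v x - v y| ≤ dist x y * (g x + g y))
    {z : Y} {R ρ₀ G₀ m : ℝ} (hρ₀ : 0 < ρ₀) (hρR : ρ₀ ≤ R) (hG₀ : 0 < G₀) (hm : 0 < m)
    (hmV : m ≤ κ * (ρ₀ / (4 * R)) ^ Q * μ.real (Metric.ball z R))
    (hdistr : ∀ k : ℕ, μ {x | G₀ / 4 ^ k < g x} ≤ ENNReal.ofReal (m / 2 * (4 ^ p) ^ k))
    {A Z : Set Y} (hA : A ⊆ Metric.ball z R) (hmA : ENNReal.ofReal m ≤ μ A)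
    (hZ : Z ⊆ Metric.ball z R) (hmZ : ENNReal.ofReal m ≤ μ Z)
    (hvA : ∀ x ∈ A \ E, v x = 1) (hvZ : ∀ x ∈ Z \ E, v x = 0) :
    1 ≤ 44 * ρ₀ * G₀ := by
  have hR : 0 < R := hρ₀.trans_le hρR
  obtain ⟨K, hK1, hK2⟩ := exists_nat_pow_near ((one_le_div hρ₀).2 hρR) one_lt_two
  rw [le_div_iff₀ hρ₀] at hK1
  rw [div_lt_iff₀ hρ₀, pow_succ] at hK2
  obtain ⟨x, hx, x', hx'E, hx'z, hgx', hvx⟩ := exists_chain_point hfin hκ hQ hpQ hE hgrad hR hρ₀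
    hG₀ hm hmV hdistr hA hmA K (by linarith)
  obtain ⟨y, hy, y', hy'E, hy'z, hgy', hvy⟩ := exists_chain_point hfin hκ hQ hpQ hE hgrad hR hρ₀
    hG₀ hm hmV hdistr hZ hmZ K (by linarith)
  rw [hvA x hx] at hvx
  rw [hvZ y hy] at hvy
  have h2K : (1 : ℝ) ≤ 2 ^ K := one_le_pow₀ one_le_two
  have hpos : 0 < ρ₀ * G₀ := by positivity
  have hle1 : 10 * ρ₀ * G₀ * (1 - 1 / 2 ^ K) ≤ 10 * ρ₀ * G₀ := by
    have : (0 : ℝ) ≤ 1 / 2 ^ K := by positivity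
    nlinarith
  have hd : dist x' y' ≤ 12 * (ρ₀ * 2 ^ K) := by
    have := dist_triangle_right x' y' z
    linarith
  have hv : |v x' - v y'| ≤ 24 * (ρ₀ * G₀) := by
    have h4 : (4 : ℝ) ^ K = 2 ^ K * 2 ^ K := by rw [← mul_pow]; norm_num
    calc |v x' - v y'| ≤ dist x' y' * (g x' + g y') := hgrad x' hx'E y' hy'E
      _ ≤ dist x' y' * (G₀ / 4 ^ K + G₀ / 4 ^ K) := by gcongr
      _ ≤ 12 * (ρ₀ * 2 ^ K) * (G₀ / 4 ^ K + G₀ / 4 ^ K) := by gcongr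
      _ = 24 * (ρ₀ * G₀) / 2 ^ K := by rw [h4]; field_simp; ring
      _ ≤ _ := div_le_self (by positivity) h2K
  have e1 := abs_le.1 (hvx.trans hle1)
  have e2 := abs_le.1 (hvy.trans hle1)
  have e3 := abs_le.1 hv
  linarith [e1.1, e2.2, e3.2]

end Necessity

section Cutoff

lemma exists_index_geometric_le {F : ℝ → ℝ} (hF : Monotone F) {r γ : ℝ} (hr : 0 < r) (hγ : 0 ≤ γ)
    (hγ1 : γ < 1) (hFr : 0 < F (r / 2)) :
    ∃ j : ℕ, F (r * (1 / 2 + (1 / 2) ^ (j + 1))) ≤ γ ^ j * F r ∧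
      γ * F (r * (1 / 2 + (1 / 2) ^ (j + 1))) ≤ F (r * (1 / 2 + (1 / 2) ^ (j + 2))) := by
  by_contra! hcon
  have key : ∀ j : ℕ, F (r * (1 / 2 + (1 / 2) ^ (j + 1))) ≤ γ ^ j * F r := by
    intro j
    induction j with
    | zero => norm_num
    | succ j ih =>
      calc F (r * (1 / 2 + (1 / 2) ^ (j + 1 + 1))) ≤ γ * F (r * (1 / 2 + (1 / 2) ^ (j + 1))) :=
            (hcon j ih).le
        _ ≤ γ * (γ ^ j * F r) := by gcongr
        _ = _ := by ring
  have hle : ∀ j : ℕ, F (r / 2) ≤ γ ^ j * F r := fun j => by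
    refine (hF ?_).trans (key j)
    have : (0 : ℝ) < (1 / 2) ^ (j + 1) := by positivity
    nlinarith
  have hlim : Filter.Tendsto (fun j : ℕ => γ ^ j * F r) Filter.atTop (nhds (0 * F r)) :=
    (tendsto_pow_atTop_nhds_zero_of_lt_one hγ hγ1).mul_const _
  have := ge_of_tendsto' hlim hle
  linarith

lemma lpN_indicator_const {Y : Type*} [MeasurableSpace Y] {μ : Measure Y} {S : Set Y}
    (hS : MeasurableSet S) {p : ℝ} (hp : 0 < p) (L : ℝ) :
    lpN μ p (fun x => ENNReal.ofReal (S.indicator (fun _ => L) x)) =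
      ENNReal.ofReal L * μ S ^ (1 / p) := by
  unfold lpN
  have : ∀ x, ENNReal.ofReal (S.indicator (fun _ => L) x) ^ p =
      S.indicator (fun _ => ENNReal.ofReal L ^ p) x := fun x => by
    by_cases hx : x ∈ S <;> simp [hx, hp]
  simp_rw [this]
  rw [lintegral_indicator_const hS, ENNReal.mul_rpow_of_nonneg _ _ (by positivity), one_div,
    ENNReal.rpow_rpow_inv hp.ne']

variable {Y : Type*} [MetricSpace Y]

/-- The Lipschitz function that is `1` on the ball of radius `s` and `0` off the ball of
radius `t`. -/
def cutoff (z : Y) (s t : ℝ) (x : Y) : ℝ := max 0 (min 1 ((t - dist x z) / (t - s)))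

lemma cutoff_nonneg (z : Y) (s t : ℝ) (x : Y) : 0 ≤ cutoff z s t x := le_max_left _ _

lemma cutoff_le_one (z : Y) (s t : ℝ) (x : Y) : cutoff z s t x ≤ 1 :=
  max_le zero_le_one (min_le_left _ _)

lemma cutoff_eq_one {z : Y} {s t : ℝ} (hst : s < t) {x : Y} (hx : dist x z < s) :
    cutoff z s t x = 1 := by
  unfold cutoff
  rw [min_eq_left, max_eq_right zero_le_one]
  rw [one_le_div (by linarith)]
  linarith

lemma cutoff_eq_zero {z : Y} {s t : ℝ} (hst : s < t) {x : Y} (hx : t ≤ dist x z) :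
    cutoff z s t x = 0 := by
  unfold cutoff
  refine max_eq_left ((min_le_right _ _).trans ?_)
  exact div_nonpos_of_nonpos_of_nonneg (by linarith) (by linarith)

lemma abs_cutoff_sub_le {z : Y} {s t : ℝ} (hst : s < t) (x y : Y) :
    |cutoff z s t x - cutoff z s t y| ≤ dist x y / (t - s) := by
  unfold cutoff
  have h1 := abs_max_sub_max_le_abs (min 1 ((t - dist x z) / (t - s)))
    (min 1 ((t - dist y z) / (t - s))) 0
  have h2 := abs_min_sub_min_le_max 1 ((t - dist x z) / (t - s)) 1 ((t - dist y z) / (t - s))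
  rw [sub_self, abs_zero, max_eq_right (abs_nonneg _), ← sub_div, abs_div,
    abs_of_pos (sub_pos.2 hst)] at h2
  rw [max_comm 0, max_comm 0]
  refine (h1.trans h2).trans ?_
  gcongr
  rw [show t - dist x z - (t - dist y z) = dist y z - dist x z by ring, abs_sub_comm]
  exact abs_dist_sub_le x y z

lemma continuous_cutoff (z : Y) (s t : ℝ) : Continuous (cutoff z s t) := by
  unfold cutoff
  fun_prop

variable [MeasurableSpace Y]

lemma isSGradOn_cutoff [OpensMeasurableSpace Y] (μ : Measure Y) (Ω : Set Y) {z : Y} {s t : ℝ}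
    (hst : s < t) :
    IsSGradOn dist μ Ω 1 (cutoff z s t) ((Metric.ball z t).indicator fun _ => (t - s)⁻¹) := by
  have hinv : 0 < (t - s)⁻¹ := inv_pos.2 (sub_pos.2 hst)
  have hnn : ∀ x, 0 ≤ (Metric.ball z t).indicator (fun _ => (t - s)⁻¹) x :=
    fun x => indicator_nonneg (fun _ _ => hinv.le) x
  refine ⟨hnn, (measurable_const.indicator Metric.isOpen_ball.measurableSet).aemeasurable, ∅,
    measure_empty, fun x _ y _ => ?_⟩
  rw [Real.rpow_one]
  by_cases hx : x ∈ Metric.ball z t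
  · refine (abs_cutoff_sub_le hst x y).trans ?_
    rw [div_eq_mul_inv, indicator_of_mem hx]
    gcongr
    exact le_add_of_nonneg_right (hnn y)
  · by_cases hy : y ∈ Metric.ball z t
    · refine (abs_cutoff_sub_le hst x y).trans ?_
      rw [div_eq_mul_inv, indicator_of_mem hy]
      gcongr
      exact le_add_of_nonneg_left (hnn x)
    · rw [Metric.mem_ball, not_lt] at hx hy
      rw [cutoff_eq_zero hst hx, cutoff_eq_zero hst hy, sub_self, abs_zero]
      exact mul_nonneg dist_nonneg (add_nonneg (hnn x) (hnn y))

/-- Extending the cutoff function from an extension domain: the extension has a gradient with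
controlled distribution. -/
lemma exists_cutoff_extension [OpensMeasurableSpace Y] {μ : Measure Y}
    (hfin : ∀ (x : Y) r, μ (Metric.ball x r) < ∞) {Ω : Set Y} {p : ℝ}
    (hp : 0 < p) {C : ℝ} (hC : 0 < C)
    (hext : ∀ u : Y → ℝ, MemM1p dist μ Ω p u →
      ∃ v : Y → ℝ, MemM1p dist μ univ p v ∧ (∀ᵐ x ∂μ.restrict Ω, v x = u x) ∧
        M1pNorm dist μ univ p v ≤ ENNReal.ofReal C * M1pNorm dist μ Ω p u)
    {z : Y} {s t : ℝ} (hst : s < t) (hst1 : t - s ≤ 1) (hFt : 0 < μ (Metric.ball z t ∩ Ω)) :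
    ∃ v g : Y → ℝ, (∀ᵐ x ∂μ.restrict Ω, v x = cutoff z s t x) ∧ IsSGradOn dist μ univ 1 v g ∧
      ∀ b : ℝ, 0 < b → μ {x | b < g x} ≤
        ENNReal.ofReal ((4 * C / (t - s) / b) ^ p * μ.real (Metric.ball z t ∩ Ω)) := by
  have hts : 0 < t - s := sub_pos.2 hst
  have hball : MeasurableSet (Metric.ball z t) := Metric.isOpen_ball.measurableSet
  have hFfin : μ (Metric.ball z t ∩ Ω) ≠ ∞ :=
    ((measure_mono inter_subset_left).trans_lt (hfin z t)).ne
  set n : ℝ≥0∞ := ENNReal.ofReal (t - s)⁻¹ * μ (Metric.ball z t ∩ Ω) ^ (1 / p) with hn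
  have hntop : n ≠ ∞ :=
    ENNReal.mul_ne_top ENNReal.ofReal_ne_top (ENNReal.rpow_ne_top_of_nonneg (by positivity) hFfin)
  have hn0 : n ≠ 0 := by
    refine mul_ne_zero (by simpa using hst) ?_
    exact (ENNReal.rpow_pos hFt hFfin).ne'
  have hlp : lpN (μ.restrict Ω) p (fun x => ENNReal.ofReal
      ((Metric.ball z t).indicator (fun _ => (t - s)⁻¹) x)) = n := by
    rw [lpN_indicator_const hball hp, Measure.restrict_apply hball]
  obtain ⟨h1, h2⟩ := M1pNorm_le_of_gradient hp (isSGradOn_cutoff μ Ω (z := z) hst)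
    (Filter.Eventually.of_forall fun x => by
      rw [abs_of_nonneg (cutoff_nonneg _ _ _ _)]
      by_cases hx : x ∈ Metric.ball z t
      · rw [indicator_of_mem hx]
        exact (cutoff_le_one _ _ _ _).trans ((one_le_inv₀ hts).2 hst1)
      · rw [indicator_of_notMem hx]
        exact (cutoff_eq_zero hst (not_lt.1 hx)).le)
  rw [hlp] at h1 h2
  obtain ⟨v, -, hvu, hvn⟩ := hext (cutoff z s t)
    ⟨(continuous_cutoff z s t).measurable.aemeasurable, ne_top_of_le_ne_top hntop h1,
      ne_top_of_le_ne_top hntop h2⟩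
  have hvn' : M1pDotNorm dist μ univ p v < ENNReal.ofReal (4 * C) * n := by
    calc M1pDotNorm dist μ univ p v ≤ M1pNorm dist μ univ p v := le_add_self
      _ ≤ ENNReal.ofReal C * (n + n) := hvn.trans (by gcongr; exact add_le_add h1 h2)
      _ = ENNReal.ofReal (2 * C) * n := by
        rw [ENNReal.ofReal_mul zero_le_two, ENNReal.ofReal_ofNat]
        ring
      _ < _ := by
        refine ENNReal.mul_lt_mul_left hn0 hntop ?_
        rw [ENNReal.ofReal_lt_ofReal_iff (by positivity)]
        linarith
  unfold M1pDotNorm at hvn'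
  simp only [iInf_lt_iff] at hvn'
  obtain ⟨g, hg, hgn⟩ := hvn'
  refine ⟨v, g, hvu, hg, fun b hb => ?_⟩
  have hgm : AEMeasurable g μ := by simpa using hg.2.1
  unfold lpN at hgn
  rw [Measure.restrict_univ, one_div, ENNReal.rpow_inv_lt_iff hp] at hgn
  have hb0 : ENNReal.ofReal b ^ p ≠ 0 := by simp [hb, not_lt.2 hp.le]
  have hbt : ENNReal.ofReal b ^ p ≠ ∞ := by simp [hp.le]
  have hmarkov := mul_meas_ge_le_lintegral₀ (hgm.ennreal_ofReal.pow_const p) (ENNReal.ofReal b ^ p)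
  calc μ {x | b < g x} ≤ μ {x | ENNReal.ofReal b ^ p ≤ ENNReal.ofReal (g x) ^ p} := by
        refine measure_mono fun x hx => ?_
        have hx' : b < g x := hx
        show ENNReal.ofReal b ^ p ≤ ENNReal.ofReal (g x) ^ p
        gcongr
    _ ≤ (ENNReal.ofReal (4 * C) * n) ^ p / ENNReal.ofReal b ^ p := by
        rw [ENNReal.le_div_iff_mul_le (Or.inl hb0) (Or.inl hbt), mul_comm]
        exact hmarkov.trans hgn.le
    _ = _ := by
        rw [hn, ← mul_assoc, ← ENNReal.ofReal_mul (by positivity),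
          ENNReal.mul_rpow_of_nonneg _ _ hp.le, one_div, ENNReal.rpow_inv_rpow hp.ne',
          ENNReal.ofReal_rpow_of_pos (by positivity), ENNReal.ofReal_rpow_of_pos hb,
          ENNReal.ofReal_mul (by positivity), ofReal_measureReal hFfin,
          Real.div_rpow (by positivity) hb.le,
          ENNReal.ofReal_div_of_pos (by positivity), div_eq_mul_inv (4 * C)]
        simp only [div_eq_mul_inv]
        ring

end Cutoff

section Necessity

variable {Y : Type*} [MetricSpace Y] [MeasurableSpace Y]

/-- In an extension domain, a ball is controlled by its concentric part in the domain, as soon as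
the surrounding annulus carries at least as much of the domain. -/
lemma measure_ball_le_of_annulus [OpensMeasurableSpace Y] {μ : Measure Y}
    (hpos : ∀ (x : Y) r, 0 < r → 0 < μ (Metric.ball x r))
    (hfin : ∀ (x : Y) r, μ (Metric.ball x r) < ∞) {κ Q : ℝ} (hκ : 0 < κ)
    (hQ : ∀ (x y : Y) (r R : ℝ), 0 < r → r ≤ R → Metric.ball x r ⊆ Metric.ball y R →
      ENNReal.ofReal (κ * (r / R) ^ Q) * μ (Metric.ball y R) ≤ μ (Metric.ball x r))
    {Ω : Set Y} (hΩ : MeasurableSet Ω)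
    (hΩpos : ∀ x ∈ Ω, ∀ r : ℝ, 0 < r → r ≤ 1 → 0 < μ (Metric.ball x r ∩ Ω))
    {p : ℝ} (hp : 0 < p) (hpQ : 2 * p ≤ Q) {C : ℝ} (hC : 0 < C)
    (hext : ∀ u : Y → ℝ, MemM1p dist μ Ω p u →
      ∃ v : Y → ℝ, MemM1p dist μ univ p v ∧ (∀ᵐ x ∂μ.restrict Ω, v x = u x) ∧
        M1pNorm dist μ univ p v ≤ ENNReal.ofReal C * M1pNorm dist μ Ω p u)
    {a : ℝ} (ha0 : 0 < a) (ha1 : a < 1) :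
    ∃ C' : ℝ, 0 < C' ∧ ∀ z ∈ Ω, ∀ R : ℝ, 0 < R → R ≤ 1 →
      μ (Metric.ball z (a * R) ∩ Ω) ≤ μ ((Metric.ball z R ∩ Ω) \ Metric.ball z (a * R)) →
      μ (Metric.ball z R) ≤ ENNReal.ofReal C' * μ (Metric.ball z (a * R) ∩ Ω) := by
  have hQ0 : 0 < Q := by linarith
  set γ : ℝ := (1 / 2) ^ Q with hγ
  have hγ0 : 0 < γ := by positivity
  have hγ1 : γ < 1 := Real.rpow_lt_one (by norm_num) (by norm_num) hQ0
  set B : ℝ := 44 * 32 * C * (2 / γ) ^ (1 / p) / a with hB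
  have hB0 : 0 < B := by positivity
  refine ⟨(4 ^ Q + B ^ Q) / κ, by positivity, fun z hz R hR hR1 hann => ?_⟩
  set r := a * R with hr
  have hr0 : 0 < r := by positivity
  have hrR : r < R := by nlinarith
  set F : ℝ → ℝ := fun t => μ.real (Metric.ball z t ∩ Ω) with hF
  have hFfin : ∀ t, μ (Metric.ball z t ∩ Ω) ≠ ∞ := fun t =>
    ((measure_mono inter_subset_left).trans_lt (hfin z t)).ne
  have hFmono : Monotone F := fun t₁ t₂ h =>
    measureReal_mono (inter_subset_inter_left _ (Metric.ball_subset_ball h)) (hFfin _)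
  have hFpos : ∀ t, 0 < t → t ≤ 1 → 0 < F t := fun t h0 h1 =>
    ENNReal.toReal_pos (hΩpos z hz t h0 h1).ne' (hFfin t)
  set V := μ.real (Metric.ball z R) with hV
  have hV0 : 0 < V := ENNReal.toReal_pos (hpos z R hR).ne' (hfin z R).ne
  suffices hmain : κ * V ≤ (4 ^ Q + B ^ Q) * F r by
    rw [← ofReal_measureReal (hfin z R).ne, ← ofReal_measureReal (hFfin r),
      ← ENNReal.ofReal_mul (by positivity)]
    apply ENNReal.ofReal_le_ofReal
    rw [div_mul_eq_mul_div, le_div_iff₀ hκ, mul_comm]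
    exact hmain
  obtain ⟨j, hj1, hj2⟩ := exists_index_geometric_le hFmono hr0 hγ0.le hγ1
    (hFpos (r / 2) (by positivity) (by linarith))
  set t := r * (1 / 2 + (1 / 2) ^ (j + 1)) with ht
  set s := r * (1 / 2 + (1 / 2) ^ (j + 2)) with hs
  have hts : t - s = r * (1 / 2) ^ (j + 2) := by rw [ht, hs]; ring
  have hst : s < t := by
    have : 0 < r * (1 / 2) ^ (j + 2) := by positivity
    linarith
  have htr : t ≤ r := by
    have : (1 / 2 : ℝ) ^ (j + 1) ≤ 1 / 2 := by
      rw [pow_succ]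
      have : (1 / 2 : ℝ) ^ j ≤ 1 := pow_le_one₀ (by norm_num) (by norm_num)
      linarith
    nlinarith
  have hs0 : 0 < s := by positivity
  have ht0 : 0 < t := hs0.trans hst
  have hFt : 0 < F t := hFpos t ht0 (by linarith)
  obtain ⟨v, g, hvu, ⟨-, -, E, hE, hgrad⟩, hdistr⟩ := exists_cutoff_extension hfin hp hC hext hst
    (by linarith) (hΩpos z hz t ht0 (by linarith))
  rw [ae_restrict_iff' hΩ, ae_iff] at hvu
  set m := γ * F t with hm
  have hm0 : 0 < m := by positivity
  have hmr : m ≤ γ ^ (j + 1) * F r := by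
    calc m ≤ γ * (γ ^ j * F r) := by rw [hm]; gcongr
      _ = _ := by ring
  have hFr : 0 < F r := hFpos r hr0 (by linarith)
  have hmF : m ≤ F r := hmr.trans (mul_le_of_le_one_left hFr.le (pow_le_one₀ hγ0.le hγ1.le))
  set G₀ := 4 * C / (t - s) * (2 / γ) ^ (1 / p) with hG
  have hts0 : 0 < t - s := sub_pos.2 hst
  have hG0 : 0 < G₀ := by positivity
  set η := (m / (κ * V)) ^ (1 / Q) with hη
  have hη0 : 0 < η := by positivity
  have hηQ : η ^ Q = m / (κ * V) := by
    rw [hη, ← Real.rpow_mul (by positivity), one_div_mul_cancel hQ0.ne', Real.rpow_one]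
  rcases lt_or_ge R (4 * R * η) with hlarge | hsmall
  · have h4 : 1 < 4 * η := by nlinarith
    have h5 : 1 ≤ 4 ^ Q * (m / (κ * V)) := by
      rw [← hηQ, ← Real.mul_rpow (by norm_num) hη0.le]
      exact Real.one_le_rpow h4.le hQ0.le
    rw [mul_div_assoc', le_div_iff₀ (by positivity), one_mul] at h5
    calc κ * V ≤ 4 ^ Q * m := h5
      _ ≤ (4 ^ Q + B ^ Q) * F r := by
        gcongr
        exact le_add_of_nonneg_right (by positivity)
  have hosc : 1 ≤ 44 * (4 * R * η) * G₀ := by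
    refine one_le_of_gradient_distribution (κ := κ) (Q := Q) (p := p) (m := m) (v := v) (g := g)
      (z := z) (R := R) (E := E ∪ {x | ¬(x ∈ Ω → v x = cutoff z s t x)})
      (A := Metric.ball z s ∩ Ω) (Z := (Metric.ball z R ∩ Ω) \ Metric.ball z r)
      hfin hκ hQ hpQ (measure_union_null hE hvu) ?_ (by positivity) hsmall hG0 hm0 ?_ ?_ ?_ ?_ ?_ ?_
      ?_ ?_
    · intro x hx y hy
      have := hgrad x ⟨mem_univ x, fun h => hx (Or.inl h)⟩ y ⟨mem_univ y, fun h => hy (Or.inl h)⟩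
      rwa [Real.rpow_one] at this
    · rw [mul_div_cancel_left₀ _ (by positivity), hηQ]
      apply le_of_eq
      field_simp
      exact hV
    · intro k
      refine (hdistr _ (by positivity)).trans (ENNReal.ofReal_le_ofReal (le_of_eq ?_))
      have h1 : 4 * C / (t - s) / (G₀ / 4 ^ k) = 4 ^ k / (2 / γ) ^ (1 / p) := by
        rw [hG]
        field_simp
      rw [h1, Real.div_rpow (by positivity) (by positivity), ← Real.rpow_mul (by positivity),
        one_div_mul_cancel hp.ne', Real.rpow_one, ← Real.rpow_natCast, ← Real.rpow_natCast,
        ← Real.rpow_mul (by norm_num), ← Real.rpow_mul (by norm_num), mul_comm (k : ℝ) p, hm]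
      field_simp
      rfl
    · exact fun x hx => Metric.ball_subset_ball (by linarith) hx.1
    · rw [← ofReal_measureReal (hFfin s)]
      exact ENNReal.ofReal_le_ofReal hj2
    · exact fun x hx => hx.1.1
    · refine le_trans ?_ hann
      rw [← ofReal_measureReal (hFfin r)]
      exact ENNReal.ofReal_le_ofReal hmF
    · intro x hx
      rw [not_not.1 (fun h => hx.2 (Or.inr h)) hx.1.2]
      exact cutoff_eq_one hst hx.1.1
    · intro x hx
      rw [not_not.1 (fun h => hx.2 (Or.inr h)) hx.1.1.2]
      exact cutoff_eq_zero hst (htr.trans (not_lt.1 hx.1.2))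
  have hηle : η ≤ (1 / 2) ^ (j + 1) * (F r / (κ * V)) ^ (1 / Q) := by
    have hγj : (γ ^ (j + 1)) ^ (1 / Q) = (1 / 2) ^ (j + 1) := by
      rw [hγ, ← Real.rpow_natCast, ← Real.rpow_natCast, ← Real.rpow_mul (by positivity),
        ← Real.rpow_mul (by norm_num)]
      · congr 1
        field_simp
    rw [← hγj, ← Real.mul_rpow (by positivity) (by positivity), hη, mul_div_assoc']
    gcongr
  have hone : 1 ≤ B * (F r / (κ * V)) ^ (1 / Q) := by
    calc 1 ≤ 44 * (4 * R * η) * G₀ := hosc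
      _ ≤ 44 * (4 * R * ((1 / 2) ^ (j + 1) * (F r / (κ * V)) ^ (1 / Q))) * G₀ := by gcongr
      _ = _ := by
        rw [hG, hts, hB, hr, pow_succ _ (j + 1)]
        field_simp
        ring
  have hone' : 1 ≤ B ^ Q * (F r / (κ * V)) := by
    calc 1 ≤ (B * (F r / (κ * V)) ^ (1 / Q)) ^ Q := Real.one_le_rpow hone hQ0.le
      _ = _ := by
        rw [Real.mul_rpow hB0.le (by positivity), ← Real.rpow_mul (by positivity),
          one_div_mul_cancel hQ0.ne', Real.rpow_one]
  rw [mul_div_assoc', le_div_iff₀ (by positivity), one_mul] at hone'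
  refine hone'.trans ?_
  gcongr
  exact le_add_of_nonneg_left (by positivity)

end Necessity

section Density

variable {Y : Type*} [MetricSpace Y] [MeasurableSpace Y]

lemma measure_ball_le_of_uniformly_perfect {μ : Measure Y} {D : ℝ} (hD1 : 1 ≤ D)
    (hD : ∀ (x : Y) r, 0 < r → μ (Metric.ball x (2 * r)) ≤ ENNReal.ofReal D * μ (Metric.ball x r))
    {Ω : Set Y} {lam : ℝ} (hlam0 : 0 < lam) (hlam1 : lam < 1) (hperf : LocUnifPerfect dist Ω lam)
    {C : ℝ} (hC : ∀ z ∈ Ω, ∀ R : ℝ, 0 < R → R ≤ 1 →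
      μ (Metric.ball z (lam / 8 * R) ∩ Ω) ≤
        μ ((Metric.ball z R ∩ Ω) \ Metric.ball z (lam / 8 * R)) →
      μ (Metric.ball z R) ≤ ENNReal.ofReal C * μ (Metric.ball z (lam / 8 * R) ∩ Ω))
    {x : Y} (hx : x ∈ Ω) {r : ℝ} (hr0 : 0 < r) (hr1 : r ≤ 1)
    (hne : (Ω \ Metric.ball x (r / 4)).Nonempty) :
    μ (Metric.ball x r) ≤
      ENNReal.ofReal D * (ENNReal.ofReal C * μ (Metric.ball x r ∩ Ω)) := by
  have hcr : lam / 8 * r < r / 8 := by nlinarith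
  rcases le_total (μ (Metric.ball x (lam / 8 * r) ∩ Ω))
    (μ ((Metric.ball x r ∩ Ω) \ Metric.ball x (lam / 8 * r))) with h | h
  · calc μ (Metric.ball x r)
        ≤ ENNReal.ofReal C * μ (Metric.ball x (lam / 8 * r) ∩ Ω) := hC x hx r hr0 hr1 h
      _ ≤ ENNReal.ofReal C * μ (Metric.ball x r ∩ Ω) := by
        gcongr
        linarith
      _ ≤ _ := le_mul_of_one_le_left' (by simpa using hD1)
  · obtain ⟨z, ⟨hzx, hz⟩, hzx'⟩ := hperf x hx (r / 4) (by positivity) (by linarith)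
      (by rwa [qball_dist])
    rw [qball_dist, Metric.mem_ball] at hzx hzx'
    have hsub : Metric.ball z (lam / 8 * r) ⊆ Metric.ball x r := fun y hy => by
      rw [Metric.mem_ball] at hy ⊢
      linarith [dist_triangle y z x]
    have hsub' : Metric.ball x (lam / 8 * r) ⊆ Metric.ball z r := fun y hy => by
      rw [Metric.mem_ball] at hy ⊢
      linarith [dist_triangle y x z, dist_comm x z]
    have hdisj : ∀ y ∈ Metric.ball z (lam / 8 * r), y ∉ Metric.ball x (lam / 8 * r) :=
      fun y hy hy' => by
        rw [Metric.mem_ball] at hy hy'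
        linarith [dist_triangle z y x, dist_comm z y]
    have hann : μ (Metric.ball z (lam / 8 * r) ∩ Ω) ≤
        μ ((Metric.ball z r ∩ Ω) \ Metric.ball z (lam / 8 * r)) := by
      refine (measure_mono fun y hy => ?_).trans (h.trans (measure_mono fun y hy => ?_))
      · exact ⟨⟨hsub hy.1, hy.2⟩, hdisj y hy.1⟩
      · exact ⟨⟨hsub' hy.1, hy.2⟩, fun hy' => hdisj y hy' hy.1⟩
    calc μ (Metric.ball x r) = μ (Metric.ball x (2 * (r / 2))) := by ring_nf
      _ ≤ ENNReal.ofReal D * μ (Metric.ball x (r / 2)) := hD x _ (by positivity)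
      _ ≤ ENNReal.ofReal D * μ (Metric.ball z r) := by
        gcongr
        intro y hy
        rw [Metric.mem_ball] at hy ⊢
        linarith [dist_triangle y x z, dist_comm x z]
      _ ≤ ENNReal.ofReal D * (ENNReal.ofReal C * μ (Metric.ball z (lam / 8 * r) ∩ Ω)) := by
        gcongr
        exact hC z hz r hr0 hr1 hann
      _ ≤ _ := by gcongr

lemma QDoubling.mono {μ : Measure Y} {Q Q' : ℝ} (h : QDoubling dist μ Q) (hQ : Q ≤ Q') :
    QDoubling dist μ Q' := by
  obtain ⟨κ, hκ, h⟩ := h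
  refine ⟨κ, hκ, fun x y r R hr hrR hsub => le_trans ?_ (h x y r R hr hrR hsub)⟩
  gcongr ENNReal.ofReal (κ * ?_) * _
  exact Real.rpow_le_rpow_of_exponent_ge (by have := hr.trans_le hrR; positivity)
    (div_le_one_of_le₀ hrR (hr.le.trans hrR)) hQ

/-- The measure density condition only has to be checked at small scales. -/
lemma MeasDensity.of_small {μ : Measure Y} {Q : ℝ} (h : QDoubling dist μ Q) {Ω : Set Y}
    {r₀ : ℝ} (hr₀ : 0 < r₀) (hr₁ : r₀ ≤ 1) {C : ℝ}
    (hC : ∀ x ∈ Ω, ∀ r : ℝ, 0 < r → r ≤ r₀ →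
      μ (Metric.ball x r) ≤ ENNReal.ofReal C * μ (Metric.ball x r ∩ Ω)) :
    MeasDensity dist μ Ω := by
  obtain ⟨κ, hκ, h⟩ := h
  have hκr : 0 < κ * r₀ ^ Q := by positivity
  refine ⟨max 1 (max C ((κ * r₀ ^ Q)⁻¹ * C)), by positivity, fun x hx r hr hr1 => ?_⟩
  rw [qball_dist]
  rcases le_total r r₀ with hrr | hrr
  · refine (hC x hx r hr hrr).trans ?_
    gcongr
    exact (le_max_left _ _).trans (le_max_right _ _)
  · have h1 := h x x r₀ 1 hr₀ hr₁ (by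
      rw [qball_dist, qball_dist]; exact Metric.ball_subset_ball hr₁)
    rw [qball_dist, qball_dist, div_one] at h1
    calc μ (Metric.ball x r) ≤ μ (Metric.ball x 1) := by gcongr
      _ = ENNReal.ofReal (κ * r₀ ^ Q)⁻¹ *
          (ENNReal.ofReal (κ * r₀ ^ Q) * μ (Metric.ball x 1)) := by
        rw [← mul_assoc, ← ENNReal.ofReal_mul (by positivity), inv_mul_cancel₀ hκr.ne',
          ENNReal.ofReal_one, one_mul]
      _ ≤ ENNReal.ofReal (κ * r₀ ^ Q)⁻¹ *
          (ENNReal.ofReal C * μ (Metric.ball x r₀ ∩ Ω)) := by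
        gcongr ENNReal.ofReal (κ * r₀ ^ Q)⁻¹ * ?_
        exact h1.trans (hC x hx r₀ hr₀ le_rfl)
      _ = ENNReal.ofReal ((κ * r₀ ^ Q)⁻¹ * C) * μ (Metric.ball x r₀ ∩ Ω) := by
        rw [ENNReal.ofReal_mul (by positivity), mul_assoc]
      _ ≤ _ := by
        gcongr
        exact (le_max_right _ _).trans (le_max_right _ _)

/-- Extension domains satisfy the measure density condition. -/
lemma measDensity_of_M1pExtDomain [OpensMeasurableSpace Y] {μ : Measure Y}
    (hpos : ∀ (x : Y) r, 0 < r → 0 < μ (Metric.ball x r))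
    (hfin : ∀ (x : Y) r, μ (Metric.ball x r) < ∞) {Q : ℝ} (hQ : QDoubling dist μ Q)
    {Ω : Set Y} (hΩ : MeasurableSet Ω)
    (hΩpos : ∀ x ∈ Ω, ∀ r : ℝ, 0 < r → r ≤ 1 → 0 < μ (Metric.ball x r ∩ Ω))
    {lam : ℝ} (hlam0 : 0 < lam) (hlam1 : lam < 1) (hperf : LocUnifPerfect dist Ω lam)
    {p : ℝ} (hp : 0 < p) (hext : M1pExtDomain dist μ Ω p) : MeasDensity dist μ Ω := by
  rcases Ω.subsingleton_or_nontrivial with hsub | ⟨a, ha, b, hb, hab⟩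
  · rcases hsub.eq_empty_or_singleton with rfl | ⟨a, rfl⟩
    · exact ⟨1, one_pos, fun x hx => absurd hx (notMem_empty x)⟩
    · have hball : ∀ r : ℝ, 0 < r → Metric.ball a r ∩ {a} = {a} := fun r hr =>
        inter_eq_right.2 (singleton_subset_iff.2 (Metric.mem_ball_self hr))
      have ha0 : μ {a} ≠ 0 := by
        simpa [hball 1 one_pos] using (hΩpos a rfl 1 one_pos le_rfl).ne'
      have hatop : μ {a} ≠ ∞ := ((measure_mono (singleton_subset_iff.2
        (Metric.mem_ball_self one_pos))).trans_lt (hfin a 1)).ne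
      refine MeasDensity.of_small hQ one_pos le_rfl (C := (μ (Metric.ball a 1) / μ {a}).toReal) ?_
      rintro x rfl r hr hr1
      rw [hball r hr, ENNReal.ofReal_toReal (ENNReal.div_lt_top (hfin _ _).ne ha0).ne,
        ENNReal.div_mul_cancel ha0 hatop]
      gcongr
  · obtain ⟨C, hC, hext⟩ := hext
    obtain ⟨D, hD1, hD⟩ := hQ.exists_doubling
    obtain ⟨κ, hκ, hκQ⟩ := hQ.mono (le_max_left Q (2 * p))
    simp only [qball_dist] at hκQ
    obtain ⟨C', hC', hann⟩ := measure_ball_le_of_annulus hpos hfin hκ hκQ hΩ hΩpos hp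
      (le_max_right Q (2 * p)) hC hext (a := lam / 8) (by positivity) (by linarith)
    have hd : 0 < dist a b := dist_pos.2 hab
    refine MeasDensity.of_small hQ (r₀ := min 1 (dist a b)) (lt_min one_pos hd) (min_le_left _ _)
      (C := D * C') fun x hx r hr hr0 => ?_
    rw [ENNReal.ofReal_mul (by positivity), mul_assoc]
    refine measure_ball_le_of_uniformly_perfect hD1 hD hlam0 hlam1 hperf hann hx hr
      (hr0.trans (min_le_left _ _)) ?_
    have hrd := hr0.trans (min_le_right _ _)
    by_contra hne
    rw [not_nonempty_iff_eq_empty, sdiff_eq_empty] at hne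
    have h1 := hne ha
    have h2 := hne hb
    rw [Metric.mem_ball] at h1 h2
    linarith [dist_triangle_right a b x]

end Density

/-- Corollary 1.3 ((a) ⟺ (b)): in a doubling metric measure space, a locally uniformly
perfect set `Ω` satisfies the measure density condition iff it is an `M^{1,p}`-extension
domain for some (equivalently, for every) `p ∈ (0,∞)`. -/
theorem measure_density_iff_M1p_extension
    {X : Type*} [MeasurableSpace X] (ρ : X → X → ℝ) (μ : Measure X)
    (hX : IsQMMS ρ μ) (hmetric : IsMetricDist ρ) (hreg : BorelRegular μ)
    (Q : ℝ) (hQ : 0 < Q) (hdoub : QDoubling ρ μ Q)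
    (Ω : Set X) (hΩmeas : MeasurableSet Ω)
    (hΩpos : ∀ x ∈ Ω, ∀ r : ℝ, 0 < r → r ≤ 1 → 0 < μ (qball ρ x r ∩ Ω))
    (hperf : ∃ lam : ℝ, 0 < lam ∧ lam < 1 ∧ LocUnifPerfect ρ Ω lam) :
    (MeasDensity ρ μ Ω ↔ ∃ p : ℝ, 0 < p ∧ M1pExtDomain ρ μ Ω p) ∧
    (MeasDensity ρ μ Ω ↔ ∀ p : ℝ, 0 < p → M1pExtDomain ρ μ Ω p) := by
  let _ : MetricSpace X := hmetric.metricSpace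
  change QDoubling dist μ Q at hdoub
  have hball : ∀ (x : X) r, qball ρ x r = Metric.ball x r := qball_dist
  have hpos : ∀ (x : X) r, 0 < r → 0 < μ (Metric.ball x r) := fun x r hr => by
    rw [← hball]
    exact hX.ball_pos x r hr
  have hfin : ∀ (x : X) r, μ (Metric.ball x r) < ∞ := fun x r => by
    rcases le_or_gt r 0 with hr | hr
    · simp [Metric.ball_eq_empty.2 hr]
    · rw [← hball]
      exact hX.ball_lt_top x r hr
  have hmeas : ∀ (x : X) r, MeasurableSet (Metric.ball x r) := fun x r => by
    rcases le_or_gt r 0 with hr | hr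
    · simp [Metric.ball_eq_empty.2 hr]
    · rw [← hball]
      exact hX.measurableSet_ball x r hr
  have hσ : SigmaFinite μ := sigmaFinite_of_ball_lt_top μ hfin
  have hsc : SecondCountableTopology X := secondCountable_of_meas_ball_pos μ hmeas hpos
  have hom : OpensMeasurableSpace X := opensMeasurable_of_measurable_ball hmeas
  have hab : MeasDensity ρ μ Ω → ∀ p : ℝ, 0 < p → M1pExtDomain ρ μ Ω p := by
    rintro ⟨c, -, hdens⟩ p hp
    obtain ⟨D, -, hD⟩ := hdoub.exists_doubling
    simp only [hball] at hdens
    exact M1pExtDomain_of_density hpos hfin ENNReal.ofReal_ne_top ENNReal.ofReal_ne_top hD hΩmeas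
      hdens hp
  have hba : (∃ p : ℝ, 0 < p ∧ M1pExtDomain ρ μ Ω p) → MeasDensity ρ μ Ω := by
    rintro ⟨p, hp, hext⟩
    obtain ⟨lam, hlam0, hlam1, hperf⟩ := hperf
    simp only [hball] at hΩpos
    exact measDensity_of_M1pExtDomain hpos hfin hdoub hΩmeas hΩpos hlam0 hlam1 hperf hp hext
  exact ⟨⟨fun h => ⟨1, one_pos, hab h 1 one_pos⟩, hba⟩,
    ⟨hab, fun h => hba ⟨1, one_pos, h 1 one_pos⟩⟩⟩

end HajlaszPaper
end
end
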